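/- arXiv:1402.4658 — 2 statements merged into one kernel-verified Lean document; each statement's English description precedes it below -/
import Mathlib

section
/- For every dimension d ≥ 2 there exists a face-to-face tiling of d-dimensional Euclidean space by convex polytopes that is monocoronal up to congruence and is exactly ⌈d/2⌉-periodic: the set of vectors v such that translation by v is a symmetry of the tiling spans a real subspace of dimension exactly ⌈d/2⌉. -/
noncomputable section

open Set

abbrev Ed (d : ℕ) := EuclideanSpace ℝ (Fin d)

variable (d : ℕ)

/-- A convex polytope: a compact convex subset with nonempty interior and finitely
many extreme points. -/
def IsConvexPolytope (P : Set (Ed d)) : Prop :=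
  IsCompact P ∧ Convex ℝ P ∧ (interior P).Nonempty ∧ (Set.extremePoints ℝ P).Finite

/-- A tiling of `ℝ^d` by convex polytopes. -/
def IsTiling (T : Set (Set (Ed d))) : Prop :=
  T.Countable ∧ (∀ P ∈ T, IsConvexPolytope d P) ∧ (⋃₀ T = Set.univ) ∧
    T.Pairwise fun P Q => Disjoint (interior P) (interior Q)

/-- A vertex of a tiling: an extreme point of at least one tile. -/
def IsVertex (T : Set (Set (Ed d))) (x : Ed d) : Prop :=
  ∃ P ∈ T, x ∈ Set.extremePoints ℝ P

/-- An isometry is orientation preserving if its linear part has determinant `1`. -/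
def OrientationPreserving (f : Ed d ≃ᵃⁱ[ℝ] Ed d) : Prop :=
  LinearMap.det (f.linearIsometryEquiv.toLinearEquiv : Ed d →ₗ[ℝ] Ed d) = 1

/-- Monocoronal up to congruence: any two vertex coronae are congruent. -/
def MonocoronalC (T : Set (Set (Ed d))) : Prop :=
  ∀ x y : Ed d, IsVertex d T x → IsVertex d T y →
    ∃ f : Ed d ≃ᵃⁱ[ℝ] Ed d, f x = y ∧
      (fun P => f '' P) '' {P | P ∈ T ∧ x ∈ P} = {P | P ∈ T ∧ y ∈ P}

/-- Monocoronal up to rigid motions: any two vertex coronae are directly congruent. -/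
def MonocoronalRM (T : Set (Set (Ed d))) : Prop :=
  ∀ x y : Ed d, IsVertex d T x → IsVertex d T y →
    ∃ f : Ed d ≃ᵃⁱ[ℝ] Ed d, OrientationPreserving d f ∧ f x = y ∧
      (fun P => f '' P) '' {P | P ∈ T ∧ x ∈ P} = {P | P ∈ T ∧ y ∈ P}

/-- A tiling is face-to-face if the intersection of any two distinct tiles is an
extreme subset of each of them. -/
def FaceToFace (T : Set (Set (Ed d))) : Prop :=
  ∀ P ∈ T, ∀ Q ∈ T, P ≠ Q → IsExtreme ℝ P (P ∩ Q) ∧ IsExtreme ℝ Q (P ∩ Q)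

/-- A symmetry of a tiling: an isometry mapping the set of tiles onto itself. -/
def IsSymmetry (T : Set (Set (Ed d))) (f : Ed d ≃ᵃⁱ[ℝ] Ed d) : Prop :=
  (fun P => f '' P) '' T = T

/-- The set of translation vectors of a tiling. -/
def periodVectors (T : Set (Set (Ed d))) : Set (Ed d) :=
  {v | IsSymmetry d T (AffineIsometryEquiv.constVAdd ℝ (Ed d) v)}

/-- Slopes of the rows: `0` on even rows, `±1` on odd rows, with one exceptional row. -/
def sl (n : ℤ) : ℤ := if n = 1 then -1 else if n % 2 = 1 then 1 else 0

variable {d}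

/-- Coordinates that are sheared. -/
def XC (i : Fin d) : Prop := i.1 % 2 = 0 ∧ i.1 + 1 < d

/-- The partner coordinate. -/
def nx (i : Fin d) : Fin d := if h : i.1 + 1 < d then ⟨i.1 + 1, h⟩ else i

open Classical in
/-- Slope of coordinate `i` in the tile indexed by `z`. -/
def SL (z : Fin d → ℤ) (i : Fin d) : ℤ := if XC i then sl (z (nx i)) else 0

def psi (z : Fin d → ℤ) (p : Ed d) (i : Fin d) : ℝ :=
  p i - (SL z i : ℝ) * (p (nx i) - z (nx i))

def tile (z : Fin d → ℤ) : Set (Ed d) :=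
  {p | ∀ i, (z i : ℝ) ≤ psi z p i ∧ psi z p i ≤ z i + 1}

lemma nx_not_XC {i : Fin d} (h : XC i) : ¬ XC (nx i) := by
  unfold XC nx at *
  rw [dif_pos h.2]
  simp only
  omega

lemma SL_of_not {z : Fin d → ℤ} {i : Fin d} (h : ¬ XC i) : SL z i = 0 := by
  simp [SL, h]

lemma SL_of {z : Fin d → ℤ} {i : Fin d} (h : XC i) : SL z i = sl (z (nx i)) := by
  simp [SL, h]

lemma psi_of_not {z : Fin d → ℤ} {p : Ed d} {i : Fin d} (h : ¬ XC i) : psi z p i = p i := by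
  simp [psi, SL_of_not h]

lemma psi_nx {z : Fin d → ℤ} {p : Ed d} {i : Fin d} (h : XC i) :
    psi z p (nx i) = p (nx i) := psi_of_not (nx_not_XC h)

lemma psi_comb (z : Fin d → ℤ) (p q : Ed d) (a b : ℝ) (h : a + b = 1) (i : Fin d) :
    psi z (a • p + b • q) i = a * psi z p i + b * psi z q i := by
  obtain rfl : b = 1 - a := by linarith
  simp only [psi, PiLp.add_apply, PiLp.smul_apply, smul_eq_mul]
  ring

def phi (z : Fin d → ℤ) : Ed d ≃ₜ (Fin d → ℝ) where
  toFun p := psi z p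
  invFun u := WithLp.toLp 2 (fun i => u i + (SL z i : ℝ) * (u (nx i) - z (nx i)))
  left_inv p := by
    ext i
    by_cases h : XC i
    · simp only [psi_nx h]
      simp [psi]
    · simp [psi, SL_of_not h]
  right_inv u := by
    ext i
    by_cases h : XC i
    · simp [psi, SL_of_not (nx_not_XC h)]
    · simp [psi, SL_of_not h]
  continuous_toFun := by
    unfold psi
    fun_prop
  continuous_invFun := by
    fun_prop

lemma tile_eq (z : Fin d → ℤ) :
    tile z = phi z ⁻¹' (Set.pi univ fun i => Icc (z i : ℝ) (z i + 1)) := by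
  ext p
  exact ⟨fun h i _ => h i, fun h i => h i (Set.mem_univ i)⟩

lemma interior_tile (z : Fin d → ℤ) {p : Ed d} :
    p ∈ interior (tile z) ↔ ∀ i, (z i : ℝ) < psi z p i ∧ psi z p i < z i + 1 := by
  rw [tile_eq, ← Homeomorph.preimage_interior, interior_pi_set Set.finite_univ]
  simp [phi, Set.mem_pi]

lemma extreme_tile (z : Fin d → ℤ) {p : Ed d} (hp : p ∈ Set.extremePoints ℝ (tile z))
    (i : Fin d) : psi z p i = z i ∨ psi z p i = z i + 1 := by
  by_contra hcon
  push Not at hcon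
  obtain ⟨h1, h2⟩ := hcon
  rw [mem_extremePoints] at hp
  obtain ⟨hm, hp⟩ := hp
  have hb := hm i
  set u := psi z p with hu
  have l1 : (z i : ℝ) < u i := lt_of_le_of_ne hb.1 (Ne.symm h1)
  have l2 : u i < z i + 1 := lt_of_le_of_ne hb.2 h2
  obtain ⟨t, ht, ht1, ht2⟩ : ∃ t : ℝ, 0 < t ∧ z i ≤ u i - t ∧ u i + t ≤ z i + 1 := by
    refine ⟨min (u i - z i) (z i + 1 - u i), ?_, ?_, ?_⟩
    · exact lt_min (by linarith) (by linarith)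
    · linarith [min_le_left (u i - z i) (z i + 1 - u i)]
    · linarith [min_le_right (u i - z i) (z i + 1 - u i)]
  have key : ∀ c : ℝ, |c| ≤ t → (phi z).symm (Function.update u i (u i + c)) ∈ tile z := by
    intro c hc
    rw [abs_le] at hc
    rw [tile_eq]
    simp only [Set.mem_preimage, Homeomorph.apply_symm_apply, Set.mem_pi]
    intro j _
    by_cases hj : j = i
    · subst hj
      simp only [Function.update_self, Set.mem_Icc]
      constructor <;> linarith
    · rw [Function.update_of_ne hj]
      exact hm j
  have e := hp _ (key t (by rw [abs_of_pos ht])) _ (key (-t) (by rw [abs_neg, abs_of_pos ht])) ?_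
  · have e1 := congrArg (fun q => phi z q i) e.1
    have : phi z p i = u i := rfl
    simp only [Homeomorph.apply_symm_apply, Function.update_self, this] at e1
    linarith
  · refine ⟨1/2, 1/2, by norm_num, by norm_num, by norm_num, ?_⟩
    apply (phi z).injective
    ext j
    change psi z _ j = psi z p j
    rw [psi_comb _ _ _ _ _ (by norm_num)]
    change 1/2 * phi z _ j + 1/2 * phi z _ j = u j
    simp only [Homeomorph.apply_symm_apply]
    by_cases hj : j = i
    · subst hj
      simp only [Function.update_self]
      ring
    · rw [Function.update_of_ne hj, Function.update_of_ne hj]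
      ring

lemma tile_polytope (z : Fin d → ℤ) : IsConvexPolytope d (tile z) := by
  refine ⟨?_, ?_, ?_, ?_⟩
  · rw [tile_eq, Homeomorph.isCompact_preimage]
    exact isCompact_univ_pi fun i => isCompact_Icc
  · intro p hp q hq a b ha hb hab i
    rw [psi_comb _ _ _ _ _ hab]
    obtain ⟨h1, h2⟩ := hp i
    obtain ⟨h3, h4⟩ := hq i
    obtain rfl : b = 1 - a := by linarith
    constructor <;> nlinarith
  · refine ⟨(phi z).symm (fun i => z i + 1/2), ?_⟩
    rw [interior_tile]
    intro i
    change _ < phi z _ i ∧ phi z _ i < _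
    simp only [Homeomorph.apply_symm_apply]
    constructor <;> linarith
  · have hf : (Set.pi univ fun i : Fin d => ({(z i : ℝ), (z i : ℝ) + 1} : Set ℝ)).Finite :=
      Set.Finite.pi fun i => Set.toFinite _
    refine Set.Finite.subset (hf.preimage (phi z).injective.injOn) ?_
    intro p hp i _
    exact extreme_tile z hp i

lemma vertex_int {p : Ed d} (hp : IsVertex d (range tile) p) : ∃ x : Fin d → ℤ, ∀ i, p i = x i := by
  obtain ⟨_, ⟨z, rfl⟩, hp⟩ := hp
  have h : ∀ i, ∃ k : ℤ, psi z p i = k := by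
    intro i
    rcases extreme_tile z hp i with h | h
    · exact ⟨z i, h⟩
    · exact ⟨z i + 1, by rw [h]; push_cast; rfl⟩
  have h' : ∀ i, ∃ k : ℤ, p i = k := by
    intro i
    by_cases hi : XC i
    · obtain ⟨k, hk⟩ := h i
      obtain ⟨l, hl⟩ := h (nx i)
      rw [psi_nx hi] at hl
      refine ⟨k + SL z i * (l - z (nx i)), ?_⟩
      rw [psi, hl] at hk
      push_cast
      linarith
    · obtain ⟨k, hk⟩ := h i
      rw [psi_of_not hi] at hk
      exact ⟨k, hk⟩
  choose x hx using h'
  exact ⟨x, hx⟩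

lemma tile_cover : ⋃₀ (range (tile (d := d))) = Set.univ := by
  classical
  rw [Set.eq_univ_iff_forall]
  intro p
  let z0 : Fin d → ℤ := fun i => ⌊p i⌋
  let z : Fin d → ℤ := fun i => ⌊psi z0 p i⌋
  have hz : ∀ i, ¬ XC i → z i = z0 i := by
    intro i hi
    simp only [z, psi_of_not hi, z0]
  have hpsi : ∀ i, psi z p i = psi z0 p i := by
    intro i
    by_cases hi : XC i
    · simp only [psi, SL_of hi, hz _ (nx_not_XC hi)]
    · rw [psi_of_not hi, psi_of_not hi]
  refine ⟨tile z, ⟨z, rfl⟩, fun i => ?_⟩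
  rw [hpsi]
  exact ⟨Int.floor_le _, (Int.lt_floor_add_one _).le⟩

lemma tile_disj : (range (tile (d := d))).Pairwise
    fun P Q => Disjoint (interior P) (interior Q) := by
  rintro _ ⟨z, rfl⟩ _ ⟨w, rfl⟩ hne
  rw [Set.disjoint_left]
  intro p hp hq
  rw [interior_tile] at hp hq
  apply hne
  have aux : ∀ (u : ℝ) (a b : ℤ), (a : ℝ) < u ∧ u < a + 1 → (b : ℝ) < u ∧ u < b + 1 → a = b := by
    intro u a b h1 h2
    have h3 : (a : ℝ) < b + 1 := by linarith
    have h4 : (b : ℝ) < a + 1 := by linarith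
    norm_cast at h3 h4
    omega
  have h0 : ∀ i, ¬ XC i → z i = w i := by
    intro i hi
    have h1 := hp i
    have h2 := hq i
    rw [psi_of_not hi] at h1 h2
    exact aux _ _ _ h1 h2
  congr 1
  ext i
  by_cases hi : XC i
  · have h1 := hp i
    have h2 := hq i
    have : psi w p i = psi z p i := by
      simp only [psi, SL_of hi, h0 _ (nx_not_XC hi)]
    rw [this] at h2
    exact aux _ _ _ h1 h2
  · exact h0 i hi

lemma seg_aux (z w : ℤ) (u u1 u2 a b : ℝ) (ha : 0 < a) (hb : 0 < b) (hab : a + b = 1)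
    (hu : a * u1 + b * u2 = u) (h1 : (z : ℝ) ≤ u1 ∧ u1 ≤ z + 1) (h2 : (z : ℝ) ≤ u2 ∧ u2 ≤ z + 1)
    (hw : (w : ℝ) ≤ u ∧ u ≤ w + 1) :
    ((w : ℝ) ≤ u1 ∧ u1 ≤ w + 1) ∧ (z ≠ w → u1 = u) := by
  obtain rfl : b = 1 - a := by linarith
  have hz1 : (z : ℝ) ≤ u := by nlinarith
  have hz2 : u ≤ z + 1 := by nlinarith
  have h3 : (z : ℝ) ≤ w + 1 := by linarith
  have h4 : (w : ℝ) ≤ z + 1 := by linarith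
  norm_cast at h3 h4
  rcases (by omega : w = z ∨ w = z + 1 ∨ w = z - 1) with h | h | h
  · subst h
    exact ⟨h1, fun h => absurd rfl h⟩
  · subst h
    push_cast at *
    have : u1 = z + 1 := by nlinarith
    exact ⟨⟨by linarith, by linarith⟩, fun _ => by linarith⟩
  · subst h
    push_cast at *
    have : u1 = z := by nlinarith
    exact ⟨⟨by linarith, by linarith⟩, fun _ => by linarith⟩

lemma ext_aux (z w : Fin d → ℤ) : IsExtreme ℝ (tile z) (tile z ∩ tile w) := by
  refine ⟨Set.inter_subset_left, ?_⟩
  rintro x1 hx1 x2 hx2 x ⟨hxz, hxw⟩ ⟨a, b, ha, hb, hab, rfl⟩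
  refine ⟨hx1, ?_⟩
  set x := a • x1 + b • x2 with hx
  have hc : ∀ i, a * psi z x1 i + b * psi z x2 i = psi z x i := fun i =>
    (psi_comb z x1 x2 a b hab i).symm
  have h0 : ∀ i, ¬ XC i → ((w i : ℝ) ≤ x1 i ∧ x1 i ≤ w i + 1) ∧ (z i ≠ w i → x1 i = x i) := by
    intro i hi
    have h1 := hx1 i
    have h2 := hx2 i
    have h3 := hxw i
    have h4 := hc i
    rw [psi_of_not hi] at h1 h2 h3
    rw [psi_of_not hi, psi_of_not hi, psi_of_not hi] at h4
    exact seg_aux _ _ _ _ _ _ _ ha hb hab h4 h1 h2 h3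
  intro i
  by_cases hi : XC i
  · obtain ⟨k, hk, hk1⟩ : ∃ k : ℤ, psi w x i = psi z x i + k ∧ psi w x1 i = psi z x1 i + k := by
      by_cases hzw : z (nx i) = w (nx i)
      · exact ⟨0, by simp [psi, SL_of hi, hzw], by simp [psi, SL_of hi, hzw]⟩
      · have e := (h0 _ (nx_not_XC hi)).2 hzw
        obtain ⟨m, hm⟩ : ∃ m : ℤ, x (nx i) = m := by
          have h1 := hxz (nx i)
          have h2 := hxw (nx i)
          rw [psi_nx hi] at h1 h2
          have h3 : (z (nx i) : ℝ) ≤ w (nx i) + 1 := by linarith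
          have h4 : (w (nx i) : ℝ) ≤ z (nx i) + 1 := by linarith
          norm_cast at h3 h4
          rcases (by omega : w (nx i) = z (nx i) + 1 ∨ z (nx i) = w (nx i) + 1) with h | h
          · refine ⟨w (nx i), ?_⟩
            rw [h] at h2 ⊢
            push_cast at *
            linarith
          · refine ⟨z (nx i), ?_⟩
            rw [h] at h1 ⊢
            push_cast at *
            linarith
        refine ⟨SL z i * (m - z (nx i)) - SL w i * (m - w (nx i)), ?_, ?_⟩
        · simp only [psi, hm]
          push_cast
          ring
        · simp only [psi, e, hm]
          push_cast
          ring
    have h3 := hxw i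
    rw [hk] at h3
    have := (seg_aux (z i) (w i - k) _ _ _ _ _ ha hb hab (hc i) (hx1 i) (hx2 i)
      (by push_cast; constructor <;> linarith)).1
    rw [hk1]
    push_cast at this
    constructor <;> linarith
  · rw [psi_of_not hi]
    exact (h0 i hi).1

/-! Monocoronality -/

/-- Diagonal sign isometry. -/
def sgnIso (a : Fin d → ℤˣ) : Ed d ≃ₗᵢ[ℝ] Ed d :=
  LinearIsometryEquiv.piLpCongrRight 2
    (fun i => if a i = 1 then LinearIsometryEquiv.refl ℝ ℝ else LinearIsometryEquiv.neg ℝ)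

lemma sgnIso_apply (a : Fin d → ℤˣ) (p : Ed d) (i : Fin d) :
    sgnIso a p i = ((a i : ℤ) : ℝ) * p i := by
  rcases Int.units_eq_one_or (a i) with h | h
  · simp [sgnIso, h]
  · have : (-1 : ℤˣ) ≠ 1 := by decide
    simp [sgnIso, h, this]

def cIso (x y : Ed d) (a : Fin d → ℤˣ) : Ed d ≃ᵃⁱ[ℝ] Ed d :=
  ((AffineIsometryEquiv.constVAdd ℝ (Ed d) (-x)).trans (sgnIso a).toAffineIsometryEquiv).trans
    (AffineIsometryEquiv.constVAdd ℝ (Ed d) y)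

lemma cIso_apply (x y : Ed d) (a : Fin d → ℤˣ) (p : Ed d) (i : Fin d) :
    cIso x y a p i = y i + ((a i : ℤ) : ℝ) * (p i - x i) := by
  simp [cIso, sgnIso_apply]
  ring

lemma unit_sq (u : ℤˣ) : ((u : ℤ) : ℝ) * ((u : ℤ) : ℝ) = 1 := by
  rcases Int.units_eq_one_or u with h | h <;> simp [h]

lemma cIso_inv (x y : Ed d) (a : Fin d → ℤˣ) (p : Ed d) : cIso x y a (cIso y x a p) = p := by
  ext i
  rw [cIso_apply, cIso_apply]
  linear_combination (p i - y i) * unit_sq (a i)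

/-- Reflected offset. -/
def rflOff (u : ℤˣ) (w : ℤ) : ℤ := if u = 1 then w else -1 - w

def Compat (x y : Fin d → ℤ) (a : Fin d → ℤˣ) : Prop :=
  ∀ i, XC i → ∀ w : ℤ, w = 0 ∨ w = -1 →
    (a i : ℤ) * sl (x (nx i) + w) = sl (y (nx i) + rflOff (a (nx i)) w) * (a (nx i) : ℤ)

lemma rflOff_inv (u : ℤˣ) (w : ℤ) : rflOff u (rflOff u w) = w := by
  unfold rflOff; split_ifs <;> omega

lemma rflOff_mem (u : ℤˣ) (w : ℤ) (h : w = 0 ∨ w = -1) : rflOff u w = 0 ∨ rflOff u w = -1 := by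
  unfold rflOff; split_ifs <;> omega

lemma Compat.symm {x y : Fin d → ℤ} {a : Fin d → ℤˣ} (h : Compat x y a) : Compat y x a := by
  intro i hi w hw
  have := h i hi _ (rflOff_mem (a (nx i)) w hw)
  rw [rflOff_inv] at this
  rcases Int.units_eq_one_or (a i) with h1 | h1 <;>
  rcases Int.units_eq_one_or (a (nx i)) with h2 | h2 <;>
  simp [h1, h2] at this ⊢ <;> linarith

lemma corona_map {x y : Fin d → ℤ} {a : Fin d → ℤˣ} (h : Compat x y a) {X Y : Ed d}
    (hX : ∀ i, X i = x i) (hY : ∀ i, Y i = y i) (z : Fin d → ℤ) (hz : X ∈ tile z) :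
    ∃ z', ∀ p, cIso X Y a p ∈ tile z' ↔ p ∈ tile z := by
  classical
  -- local offsets
  let w : Fin d → ℤ := fun i => z i - x i + SL z i * (x (nx i) - z (nx i))
  have hw : ∀ i, w i = 0 ∨ w i = -1 := by
    intro i
    have := hz i
    simp only [psi, hX] at this
    norm_cast at this
    simp only [w]
    omega
  have hw0 : ∀ i, ¬ XC i → w i = z i - x i := by
    intro i hi
    simp [w, SL_of_not hi]
  let z0 : Fin d → ℤ := fun i => y i + rflOff (a i) (w i)
  let z' : Fin d → ℤ := fun i => z0 i - SL z0 i * (y (nx i) - z0 (nx i))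
  have hz0 : ∀ i, ¬ XC i → z' i = z0 i := by
    intro i hi
    simp [z', SL_of_not hi]
  have hS : ∀ i, SL z' i = SL z0 i := by
    intro i
    by_cases hi : XC i
    · rw [SL_of hi, SL_of hi, hz0 _ (nx_not_XC hi)]
    · rw [SL_of_not hi, SL_of_not hi]
  refine ⟨z', fun p => ?_⟩
  unfold tile
  simp only [Set.mem_ofPred_eq]
  refine forall_congr' fun i => ?_
  -- relation
  have hcomp : (a i : ℤ) * SL z i = SL z0 i * (a (nx i) : ℤ) := by
    by_cases hi : XC i
    · have := h i hi _ (hw (nx i))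
      rw [SL_of hi, SL_of hi]
      rw [← this, hw0 _ (nx_not_XC hi)]
      congr 2
      ring
    · simp [SL_of_not hi]
  have hcompR : ((a i : ℤ) : ℝ) * SL z i = SL z0 i * ((a (nx i) : ℤ) : ℝ) := by
    exact_mod_cast hcomp
  have key : psi z' (cIso X Y a p) i - z' i =
      ((a i : ℤ) : ℝ) * (psi z p i - z i + w i) - rflOff (a i) (w i) := by
    have hnn : (SL z0 i : ℝ) * z' (nx i) = SL z0 i * z0 (nx i) := by
      by_cases hi : XC i
      · rw [hz0 _ (nx_not_XC hi)]
      · simp [SL_of_not hi]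
    simp only [psi, cIso_apply, hS, hX, hY]
    have e1 : (z' i : ℝ) = y i + rflOff (a i) (w i) - SL z0 i * (y (nx i) - z0 (nx i)) := by
      simp only [z', z0]; push_cast; ring
    have e2 : (w i : ℝ) = z i - x i + SL z i * (x (nx i) - z (nx i)) := by
      simp only [w]; push_cast; ring
    rw [e1, e2]
    linear_combination (p (nx i) - x (nx i)) * hcompR + hnn
  have k2 : ((z' i : ℝ) ≤ psi z' (cIso X Y a p) i ∧ psi z' (cIso X Y a p) i ≤ z' i + 1) ↔
      (0 ≤ psi z' (cIso X Y a p) i - z' i ∧ psi z' (cIso X Y a p) i - z' i ≤ 1) := by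
    constructor <;> rintro ⟨h1, h2⟩ <;> constructor <;> linarith
  rw [k2, key]
  have : (-1 : ℤˣ) ≠ 1 := by decide
  rcases Int.units_eq_one_or (a i) with h1 | h1 <;> simp only [h1, rflOff, this, if_true, if_false] <;>
    push_cast <;> constructor <;> rintro ⟨h2, h3⟩ <;> constructor <;> linarith

lemma exists_compat (x y : Fin d → ℤ) : ∃ a, Compat x y a := by
  classical
  let b : Fin d → ℤˣ := fun i => if (x i - y i) % 2 = 0 then 1 else -1
  let σ : ℤ → ℤˣ := fun n => if n = 1 ∨ n = 2 then -1 else 1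
  refine ⟨fun i => if XC i then b (nx i) * σ (x (nx i)) * σ (y (nx i)) else b i, ?_⟩
  intro i hi w hw
  simp only [hi, nx_not_XC hi, if_true, if_false, b]
  generalize x (nx i) = m
  generalize y (nx i) = n
  have hne : (-1 : ℤˣ) ≠ 1 := by decide
  have hσ : ∀ n : ℤ, ((σ n : ℤˣ) : ℤ) = if n = 1 ∨ n = 2 then -1 else 1 := by
    intro n; simp only [σ]; split_ifs <;> rfl
  by_cases hp : (m - n) % 2 = 0
  · simp only [hp, if_true, rflOff, Units.val_mul, hσ, Units.val_one, sl]
    rcases hw with rfl | rfl <;> split_ifs <;> omega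
  · simp only [hp, if_false, rflOff, hne, Units.val_mul, hσ, Units.val_one, Units.val_neg, sl]
    rcases hw with rfl | rfl <;> split_ifs <;> omega

lemma corona_sub {x y : Fin d → ℤ} {a : Fin d → ℤˣ} (h : Compat x y a) {X Y : Ed d}
    (hX : ∀ i, X i = x i) (hY : ∀ i, Y i = y i) (P : Set (Ed d)) (hP : P ∈ range (tile (d := d)))
    (hXP : X ∈ P) : cIso X Y a '' P ∈ range (tile (d := d)) ∧ Y ∈ cIso X Y a '' P := by
  obtain ⟨z, rfl⟩ := hP
  obtain ⟨z', hz'⟩ := corona_map h hX hY z hXP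
  refine ⟨⟨z', ?_⟩, ⟨X, hXP, ?_⟩⟩
  · ext p
    constructor
    · intro hp
      refine ⟨cIso Y X a p, ?_, cIso_inv _ _ _ _⟩
      rw [← hz', cIso_inv]
      exact hp
    · rintro ⟨q, hq, rfl⟩
      exact (hz' q).2 hq
  · ext i
    simp [cIso_apply]

lemma mono : MonocoronalC d (range tile) := by
  intro X Y hX hY
  obtain ⟨x, hx⟩ := vertex_int hX
  obtain ⟨y, hy⟩ := vertex_int hY
  obtain ⟨a, ha⟩ := exists_compat x y
  refine ⟨cIso X Y a, ?_, ?_⟩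
  · ext i
    simp [cIso_apply]
  · ext Q
    constructor
    · rintro ⟨P, ⟨hP, hXP⟩, rfl⟩
      exact corona_sub ha hx hy P hP hXP
    · rintro ⟨hQ, hYQ⟩
      refine ⟨cIso Y X a '' Q, corona_sub ha.symm hy hx Q hQ hYQ, ?_⟩
      simp only [Set.image_image, cIso_inv, Set.image_id']

/-! Periods -/

lemma mem_period {v : Ed d} (hv : v ∈ periodVectors d (range tile)) (z : Fin d → ℤ) :
    ∃ z', ∀ p, p ∈ tile z → v + p ∈ tile z' := by
  have h : (fun P => (AffineIsometryEquiv.constVAdd ℝ (Ed d) v) '' P) (tile z) ∈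
      range (tile (d := d)) := by
    rw [← (show _ = range (tile (d := d)) from hv)]
    exact ⟨tile z, ⟨z, rfl⟩, rfl⟩
  obtain ⟨z', hz'⟩ := h
  refine ⟨z', fun p hp => ?_⟩
  rw [hz']
  exact ⟨p, hp, by simp⟩

lemma period_zero {v : Ed d} (hv : v ∈ periodVectors d (range tile)) (i : Fin d) (hi : XC i) :
    v (nx i) = 0 := by
  classical
  obtain ⟨z', hz'⟩ := mem_period hv (fun _ => 1)
  set z : Fin d → ℤ := fun _ => 1 with hz
  have hne : nx i ≠ i := by
    intro h
    exact nx_not_XC hi (by rw [h]; exact hi)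
  -- test points
  let pt : ℝ → ℝ → Ed d := fun s t => (phi z).symm
    (Function.update (Function.update (fun i => (z i : ℝ)) i (z i + s)) (nx i) (z (nx i) + t))
  have hpt : ∀ s t : ℝ, 0 ≤ s → s ≤ 1 → 0 ≤ t → t ≤ 1 → pt s t ∈ tile z := by
    intro s t h1 h2 h3 h4
    rw [tile_eq]
    simp only [pt, Set.mem_preimage, Homeomorph.apply_symm_apply, Set.mem_pi]
    intro j _
    by_cases hj : j = nx i
    · subst hj
      simp only [Function.update_self, Set.mem_Icc]
      constructor <;> linarith
    · rw [Function.update_of_ne hj]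
      by_cases hj : j = i
      · subst hj
        simp only [Function.update_self, Set.mem_Icc]
        constructor <;> linarith
      · rw [Function.update_of_ne hj]
        simp
  have hj : ∀ s t, pt s t (nx i) = 1 + t := by
    intro s t
    simp [pt, phi, SL_of_not (nx_not_XC hi), hz]
  have hii : ∀ s t, pt s t i = 1 + s - t := by
    intro s t
    simp [pt, phi, SL_of hi, hz, sl, Function.update_of_ne hne.symm]
    ring
  have hz0 := hz' _ (hpt 0 0 (by norm_num) (by norm_num) (by norm_num) (by norm_num))
  have hz1 := hz' _ (hpt 1 0 (by norm_num) (by norm_num) (by norm_num) (by norm_num))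
  have hz2 := hz' _ (hpt 0 1 (by norm_num) (by norm_num) (by norm_num) (by norm_num))
  have hz3 := hz' _ (hpt 1 1 (by norm_num) (by norm_num) (by norm_num) (by norm_num))
  have a0 := hz0 (nx i)
  have a2 := hz2 (nx i)
  rw [psi_nx hi, PiLp.add_apply, hj] at a0 a2
  have hvj : v (nx i) = z' (nx i) - 1 := by linarith
  have b0 := hz0 i
  have b1 := hz1 i
  have b2 := hz2 i
  have b3 := hz3 i
  simp only [psi, PiLp.add_apply, hj, hii, hvj] at b0 b1 b2 b3
  have hvi : v i = z' i - 1 := by linarith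
  rw [hvi] at b2 b3
  have hS : (SL z' i : ℝ) = -1 := by linarith
  have hS' : SL z' i = -1 := by exact_mod_cast hS
  rw [SL_of hi, sl] at hS'
  split_ifs at hS' with h
  · rw [hvj, h]; simp

lemma e_period (k : Fin d) (hk : k.1 % 2 = 0) :
    EuclideanSpace.single k (1 : ℝ) ∈ periodVectors d (range tile) := by
  classical
  have hnk : ∀ i, XC i → nx i ≠ k := by
    intro i hi h
    have h2 := hi.1
    have : (nx i).1 = i.1 + 1 := by simp [nx, hi.2]
    rw [h] at this
    omega
  have key : ∀ (z : Fin d → ℤ) (m : ℤ) (p : Ed d), p ∈ tile z →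
      EuclideanSpace.single k (m : ℝ) + p ∈ tile (z + Pi.single k m) := by
    intro z m p hp i
    have h1 := hp i
    have e : psi (z + Pi.single k m) (EuclideanSpace.single k (m : ℝ) + p) i =
        psi z p i + (Pi.single k m : Fin d → ℤ) i := by
      by_cases hi : XC i
      · simp [psi, SL_of hi, hnk i hi, Pi.single_apply]
        ring
      · simp [psi_of_not hi, Pi.single_apply]
        ring
    rw [e]
    push_cast [Pi.add_apply]
    constructor <;> linarith
  have key2 : ∀ (z : Fin d → ℤ) (m : ℤ),
      (AffineIsometryEquiv.constVAdd ℝ (Ed d) (EuclideanSpace.single k (m : ℝ))) '' tile z =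
        tile (z + Pi.single k m) := by
    intro z m
    ext p
    constructor
    · rintro ⟨q, hq, rfl⟩
      simpa using key z m q hq
    · intro hp
      refine ⟨EuclideanSpace.single k ((-m : ℤ) : ℝ) + p, ?_, ?_⟩
      · have := key _ (-m) p hp
        rwa [add_assoc, ← Pi.single_add, add_neg_cancel, Pi.single_zero, add_zero] at this
      · ext i
        simp [Pi.single_apply]
        split_ifs <;> simp
  have h1 := fun z => key2 z 1
  have h2 := fun z => key2 z 1
  simp only [Int.cast_one] at h1
  change _ '' _ = _
  ext Q
  constructor
  · rintro ⟨_, ⟨z, rfl⟩, rfl⟩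
    exact ⟨_, (h1 z).symm⟩
  · rintro ⟨z, rfl⟩
    refine ⟨_, ⟨z - Pi.single k 1, rfl⟩, ?_⟩
    simp only [h1, sub_add_cancel]

lemma finrank_period :
    Module.finrank ℝ (Submodule.span ℝ (periodVectors d (range tile))) = (d + 1) / 2 := by
  classical
  let c : Fin ((d + 1) / 2) → Fin d := fun k => ⟨2 * k.1, by omega⟩
  have hc : Function.Injective c := by
    intro k l h
    simp only [c, Fin.mk.injEq] at h
    ext
    omega
  let e : Fin ((d + 1) / 2) → Ed d := fun k => EuclideanSpace.single (c k) (1 : ℝ)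
  have hli : LinearIndependent ℝ e := by
    have h := (EuclideanSpace.basisFun (Fin d) ℝ).orthonormal.linearIndependent.comp c hc
    have he : e = (EuclideanSpace.basisFun (Fin d) ℝ) ∘ c := by
      funext k
      simp [e]
    rw [he]
    exact h
  have hspan : Submodule.span ℝ (periodVectors d (range tile)) = Submodule.span ℝ (range e) := by
    apply le_antisymm
    · rw [Submodule.span_le]
      intro v hv
      have hv' : v = ∑ i, v i • EuclideanSpace.single i (1 : ℝ) := by
        ext j
        simp [Pi.single_apply]
      rw [hv']
      refine Submodule.sum_mem _ fun i _ => ?_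
      by_cases hi : i.1 % 2 = 0
      · apply Submodule.smul_mem
        apply Submodule.subset_span
        refine ⟨⟨i.1 / 2, by omega⟩, ?_⟩
        simp only [e]
        congr 1
        ext
        simp only [c]
        omega
      · have hX : XC (⟨i.1 - 1, by omega⟩ : Fin d) := by
          constructor
          · simp only; omega
          · simp only; omega
        have hn : nx (⟨i.1 - 1, by omega⟩ : Fin d) = i := by
          have := hX.2
          simp only [nx] at this ⊢
          rw [dif_pos this]
          ext
          simp only
          omega
        have := period_zero hv _ hX
        rw [hn] at this
        rw [this, zero_smul]
        exact Submodule.zero_mem _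
    · rw [Submodule.span_le]
      rintro _ ⟨k, rfl⟩
      exact Submodule.subset_span (e_period _ (by simp [c]))
  rw [hspan, finrank_span_eq_card hli, Fintype.card_fin]

variable (d)

lemma main_thm : ∃ T : Set (Set (Ed d)), IsTiling d T ∧ FaceToFace d T ∧ MonocoronalC d T ∧
      Module.finrank ℝ (Submodule.span ℝ (periodVectors d T)) = (d + 1) / 2 := by
  refine ⟨range tile, ⟨Set.countable_range _, ?_, tile_cover, tile_disj⟩, ?_, mono, finrank_period⟩
  · rintro _ ⟨z, rfl⟩
    exact tile_polytope z
  · rintro _ ⟨z, rfl⟩ _ ⟨w, rfl⟩ _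
    refine ⟨ext_aux z w, ?_⟩
    rw [Set.inter_comm]
    exact ext_aux w z

/-- For every `d ≥ 2` there is a face-to-face monocoronal (up to congruence) tiling
of `ℝ^d` that is exactly `⌈d/2⌉`-periodic. -/
theorem exists_faceToFace_monocoronalC_ceil_half_periodic (hd : 2 ≤ d) :
    ∃ T : Set (Set (Ed d)), IsTiling d T ∧ FaceToFace d T ∧ MonocoronalC d T ∧
      Module.finrank ℝ (Submodule.span ℝ (periodVectors d T)) = (d + 1) / 2 := by
  exact main_thm d
end
end

section
/- For every dimension d ≥ 3 there exists a tiling of d-dimensional Euclidean space by convex polytopes that is not face-to-face, is monocoronal up to congruence, and is non-periodic: the only vector v such that translation by v is a symmetry of the tiling is v = 0. -/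
noncomputable section

open Set

variable (d : ℕ)

/-! ## Action of isometries on families of sets -/

/-- The image of a family of sets under an isometry. -/
def act {d : ℕ} (f : Ed d ≃ᵃⁱ[ℝ] Ed d) (U : Set (Set (Ed d))) : Set (Set (Ed d)) :=
  (fun P => f '' P) '' U

theorem act_mul {d : ℕ} (f g : Ed d ≃ᵃⁱ[ℝ] Ed d) (U : Set (Set (Ed d))) :
    act (f * g) U = act f (act g U) := by
  simp only [act, image_image, AffineIsometryEquiv.coe_mul, image_comp]

theorem act_one {d : ℕ} (U : Set (Set (Ed d))) : act (1 : Ed d ≃ᵃⁱ[ℝ] Ed d) U = U := by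
  simp [act]

theorem act_union {d : ℕ} (f : Ed d ≃ᵃⁱ[ℝ] Ed d) (U V : Set (Set (Ed d))) :
    act f (U ∪ V) = act f U ∪ act f V := image_union _ _ _

theorem act_eq_of_subset {d : ℕ} {f : Ed d ≃ᵃⁱ[ℝ] Ed d} {U : Set (Set (Ed d))}
    (h1 : act f U ⊆ U) (h2 : act f⁻¹ U ⊆ U) : act f U = U := by
  apply Subset.antisymm h1
  have := image_mono (f := fun P : Set (Ed d) => f '' P) h2
  change act f (act f⁻¹ U) ⊆ act f U at this
  rwa [← act_mul, mul_inv_cancel, act_one] at this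

/-- Congruence of the coronae at `x` in `U` and at `y` in `V`. -/
def Cong {d : ℕ} (U : Set (Set (Ed d))) (x : Ed d) (V : Set (Set (Ed d))) (y : Ed d) : Prop :=
  ∃ f : Ed d ≃ᵃⁱ[ℝ] Ed d, f x = y ∧
      (fun P => f '' P) '' {P | P ∈ U ∧ x ∈ P} = {P | P ∈ V ∧ y ∈ P}

theorem Cong.trans {d : ℕ} {U V W : Set (Set (Ed d))} {x y z : Ed d}
    (h1 : Cong U x V y) (h2 : Cong V y W z) : Cong U x W z := by
  obtain ⟨f, hf, hf'⟩ := h1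
  obtain ⟨g, hg, hg'⟩ := h2
  refine ⟨g * f, by simp [hf, hg], ?_⟩
  have := act_mul g f {P | P ∈ U ∧ x ∈ P}
  unfold act at this
  rw [this, hf', hg']

theorem Cong.symm {d : ℕ} {U V : Set (Set (Ed d))} {x y : Ed d}
    (h1 : Cong U x V y) : Cong V y U x := by
  obtain ⟨f, hf, hf'⟩ := h1
  refine ⟨f⁻¹, by simp [← hf], ?_⟩
  rw [← hf']
  change act f⁻¹ (act f _) = _
  rw [← act_mul, inv_mul_cancel, act_one]

theorem cong_act {d : ℕ} (U : Set (Set (Ed d))) (f : Ed d ≃ᵃⁱ[ℝ] Ed d) (x : Ed d) :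
    Cong U x (act f U) (f x) := by
  refine ⟨f, rfl, ?_⟩
  ext S
  constructor
  · rintro ⟨P, ⟨hP, hx⟩, rfl⟩
    exact ⟨⟨P, hP, rfl⟩, mem_image_of_mem _ hx⟩
  · rintro ⟨⟨P, hP, rfl⟩, hx⟩
    refine ⟨P, ⟨hP, ?_⟩, rfl⟩
    obtain ⟨y, hy, hyx⟩ := hx
    rwa [← f.injective hyx]

/-- Translations. -/
abbrev tr {d : ℕ} (w : Ed d) : Ed d ≃ᵃⁱ[ℝ] Ed d := AffineIsometryEquiv.constVAdd ℝ (Ed d) w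

theorem tr_apply {d : ℕ} (w x : Ed d) : tr w x = w + x := rfl

theorem tr_inv {d : ℕ} (w : Ed d) : (tr w)⁻¹ = tr (-w) := by
  rw [inv_eq_iff_mul_eq_one]
  ext x : 1
  simp

/-! ## A walk through a group generated by involutions -/

theorem exists_walk {G I : Type*} [Group G] [Countable I] (i0 : I) (s : I → G)
    (hs : ∀ i, s i * s i = 1) :
    ∃ i : ℕ → I, ∃ f : ℕ → G, f 0 = 1 ∧ (∀ n, f (n + 1) = f n * s (i n)) ∧
      ∀ l : List I, ∃ n, f n = (l.map s).prod := by
  classical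
  have : Nonempty (List I) := ⟨[]⟩
  obtain ⟨W, hW⟩ := exists_surjective_nat (List I)
  let v : ℕ → G := fun k => ((W k).map s).prod
  have hrev : ∀ l : List I, ((l.map s).prod)⁻¹ = (l.reverse.map s).prod := by
    intro l
    induction l with
    | nil => simp
    | cons a t ih =>
      simp only [List.map_cons, List.prod_cons, mul_inv_rev, ih, List.reverse_cons, List.map_append,
        List.prod_append, List.map_nil, List.prod_nil, mul_one]
      rw [inv_eq_of_mul_eq_one_left (hs a)]
  -- one step towards the target
  have hstep : ∀ l : List I, ∀ c t : G, c * (l.map s).prod = t → c ≠ t →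
      ∃ i, ∃ l' : List I, l'.length < l.length ∧ c * s i * (l'.map s).prod = t := by
    intro l c t h hne
    cases l with
    | nil => exact absurd (by simpa using h) hne
    | cons a t' => exact ⟨a, t', by simp, by simpa [mul_assoc] using h⟩
  -- states: position, index of the target, remaining path
  let St := {p : G × ℕ × List I // p.1 * (p.2.2.map s).prod = v p.2.1}
  have hnext : ∀ p : St, ∃ q : I × St, q.2.1.1 = p.1.1 * s q.1 ∧
      ((p.1.1 = v p.1.2.1 ∧ q.2.1.2.1 = p.1.2.1 + 1) ∨
       (p.1.1 ≠ v p.1.2.1 ∧ q.2.1.2.1 = p.1.2.1 ∧ q.2.1.2.2.length < p.1.2.2.length)) := by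
    rintro ⟨⟨c, k, l⟩, h⟩
    by_cases hc : c = v k
    · refine ⟨⟨i0, ⟨⟨c * s i0, k + 1, i0 :: ((W k).reverse ++ W (k + 1))⟩, ?_⟩⟩, rfl,
        Or.inl ⟨hc, rfl⟩⟩
      simp only [List.map_cons, List.prod_cons, List.map_append, List.prod_append, ← hrev]
      rw [mul_assoc, ← mul_assoc (s i0), hs, one_mul, hc]
      simp [v]
    · obtain ⟨i, l', hl, he⟩ := hstep l c (v k) h hc
      exact ⟨⟨i, ⟨⟨c * s i, k, l'⟩, he⟩⟩, rfl, Or.inr ⟨hc, rfl, hl⟩⟩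
  choose nx hnx1 hnx2 using hnext
  let st : ℕ → St := fun n => Nat.rec ⟨⟨1, 0, W 0⟩, by simp [v]⟩ (fun _ p => (nx p).2) n
  have hst : ∀ n, st (n + 1) = (nx (st n)).2 := fun n => rfl
  have key : ∀ m : ℕ, ∀ n, (st n).1.2.2.length ≤ m →
      ∃ n', (st n').1.1 = v (st n).1.2.1 ∧ (st n').1.2.1 = (st n).1.2.1 := by
    intro m
    induction m with
    | zero =>
      intro n hn
      rcases hnx2 (st n) with h | h
      · exact ⟨n, h.1, rfl⟩
      · omega
    | succ m ih =>
      intro n hn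
      rcases hnx2 (st n) with h | h
      · exact ⟨n, h.1, rfl⟩
      · obtain ⟨n', h1, h2⟩ := ih (n + 1) (by rw [hst]; omega)
        rw [hst, h.2.1] at h1 h2
        exact ⟨n', h1, h2⟩
  have key2 : ∀ k, ∃ n, (st n).1.1 = v k ∧ (st n).1.2.1 = k := by
    intro k
    induction k with
    | zero => exact key _ 0 le_rfl
    | succ k ih =>
      obtain ⟨n, h1, h2⟩ := ih
      rcases hnx2 (st n) with h | h
      · obtain ⟨n', h3, h4⟩ := key _ (n + 1) le_rfl
        rw [hst, h.2, h2] at h3 h4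
        exact ⟨n', h3, h4⟩
      · exact absurd (by rw [h1, h2]) h.1
  refine ⟨fun n => (nx (st n)).1, fun n => (st n).1.1, rfl, fun n => hnx1 (st n), fun l => ?_⟩
  obtain ⟨k, rfl⟩ := hW l
  obtain ⟨n, hn, -⟩ := key2 k
  exact ⟨n, hn⟩

/-! ## The basis -/

/-- The Gram conditions on the basis: `b 0` is a unit vector orthogonal to the other basis
vectors, which are unit vectors with mutual inner products `1/4`. -/
structure Good {k : ℕ} (b : Module.Basis (Fin (k + 3)) ℝ (Ed (k + 3))) : Prop where
  h00 : inner ℝ (b 0) (b 0) = 1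
  h0 : ∀ i : Fin (k + 2), inner ℝ (b 0) (b i.succ) = 0
  hii : ∀ i : Fin (k + 2), inner ℝ (b i.succ) (b i.succ) = 1
  hij : ∀ i j : Fin (k + 2), i ≠ j → inner ℝ (b i.succ) (b j.succ) = 1 / 4

theorem exists_good (k : ℕ) : ∃ b : Module.Basis (Fin (k + 3)) ℝ (Ed (k + 3)), Good b := by
  obtain ⟨a, ha⟩ : ∃ a : ℝ, a ^ 2 = 3 / 4 := ⟨√(3 / 4), Real.sq_sqrt (by norm_num)⟩
  obtain ⟨β, hβ⟩ : ∃ β : ℝ, (k + 2 : ℝ) * β ^ 2 + 2 * a * β = 1 / 4 := by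
    have hk : (k + 2 : ℝ) ≠ 0 := by positivity
    refine ⟨(-a + √(a ^ 2 + (k + 2) / 4)) / (k + 2), ?_⟩
    have : √(a ^ 2 + (k + 2 : ℝ) / 4) ^ 2 = a ^ 2 + (k + 2 : ℝ) / 4 :=
      Real.sq_sqrt (by positivity)
    field_simp
    ring_nf at this ⊢
    rw [this]
    ring
  let v : Fin (k + 3) → Ed (k + 3) := fun j =>
    WithLp.toLp 2 (Fin.cases (motive := fun _ => Fin (k + 3) → ℝ)
      (fun l => if l = 0 then 1 else 0)
      (fun i l => (if l = i.succ then a else 0) + (if l = 0 then 0 else β)) j)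
  have g00 : inner ℝ (v 0) (v 0) = 1 := by
    simp only [v, PiLp.inner_apply]
    simp
  have g0 : ∀ i : Fin (k + 2), inner ℝ (v 0) (v i.succ) = 0 := by
    intro i
    simp [v, PiLp.inner_apply, Fin.sum_univ_succ, (Fin.succ_ne_zero _).symm]
  have gg : ∀ i j : Fin (k + 2), inner ℝ (v i.succ) (v j.succ) = (if i = j then a ^ 2 else 0)
      + 1 / 4 := by
    intro i j
    simp only [v, PiLp.inner_apply, Fin.sum_univ_succ (n := k + 2), Fin.cases_succ,
      (Fin.succ_ne_zero _).symm, Fin.succ_ne_zero, Fin.succ_inj]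
    simp only [RCLike.inner_apply, conj_trivial, if_true, if_false, add_mul, mul_add,
      Finset.sum_add_distrib, ite_mul, mul_ite, zero_mul, mul_zero, Finset.sum_ite_eq',
      Finset.sum_ite_eq, Finset.mem_univ, Finset.sum_const, Finset.card_univ, Fintype.card_fin,
      nsmul_eq_mul]
    rw [← hβ]
    by_cases h : i = j
    · subst h; simp; ring
    · simp [h, Ne.symm h]; ring
  have hli : LinearIndependent ℝ v := by
    rw [Fintype.linearIndependent_iff]
    intro g hg
    have e0 : g 0 = 0 := by
      have : inner ℝ (v 0) (∑ i, g i • v i) = 0 := by rw [hg, inner_zero_right]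
      rw [Fin.sum_univ_succ, inner_add_right, inner_sum] at this
      simp only [inner_smul_right, g00, g0] at this
      simpa using this
    have e1 : ∀ i : Fin (k + 2), 3 / 4 * g i.succ + 1 / 4 * ∑ j : Fin (k + 2), g j.succ = 0 := by
      intro i
      have : inner ℝ (v i.succ) (∑ i, g i • v i) = 0 := by rw [hg, inner_zero_right]
      rw [Fin.sum_univ_succ, inner_add_right, inner_sum] at this
      simp only [inner_smul_right, gg, e0, zero_mul, zero_add, ha, mul_add, Finset.sum_add_distrib,
        mul_ite, mul_zero, Finset.sum_ite_eq, Finset.mem_univ, if_true, ← Finset.sum_mul] at this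
      linarith
    have e2 : ∑ j : Fin (k + 2), g j.succ = 0 := by
      have := Finset.sum_congr rfl (fun i (_ : i ∈ Finset.univ) => e1 i)
      rw [Finset.sum_add_distrib, ← Finset.mul_sum] at this
      simp only [Finset.sum_const, Finset.card_univ, Fintype.card_fin, nsmul_eq_mul,
        mul_zero] at this
      push_cast at this
      have h2 : (3 / 4 + (k + 2) / 4 : ℝ) * ∑ j : Fin (k + 2), g j.succ = 0 := by linarith
      exact (mul_eq_zero.1 h2).resolve_left (by positivity)
    intro i
    refine Fin.cases e0 (fun i => ?_) i
    have := e1 i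
    rw [e2] at this
    linarith
  let b : Module.Basis (Fin (k + 3)) ℝ (Ed (k + 3)) :=
    basisOfLinearIndependentOfCardEqFinrank hli (by simp)
  have hb : ∀ j, b j = v j := fun j => by simp [b]
  refine ⟨b, ?_, ?_, ?_, ?_⟩
  · rw [hb, g00]
  · intro i; rw [hb, hb, g0]
  · intro i; rw [hb, gg, if_pos rfl, ha]; norm_num
  · intro i j h; rw [hb, hb, gg, if_neg h]; norm_num

section geom

variable {k : ℕ} {b : Module.Basis (Fin (k + 3)) ℝ (Ed (k + 3))}

theorem Good.inner_zero (hb : Good b) (x : Ed (k + 3)) : inner ℝ (b 0) x = b.repr x 0 := by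
  conv_lhs => rw [← b.sum_repr x]
  rw [Fin.sum_univ_succ, inner_add_right, inner_sum]
  simp only [inner_smul_right, hb.h00, hb.h0]
  simp

theorem Good.inner_succ (hb : Good b) (i : Fin (k + 2)) (x : Ed (k + 3)) :
    inner ℝ (b i.succ) x = 3 / 4 * b.repr x i.succ + 1 / 4 * ∑ j : Fin (k + 2), b.repr x j.succ := by
  conv_lhs => rw [← b.sum_repr x]
  rw [Fin.sum_univ_succ, inner_add_right, inner_sum]
  have h : ∀ j : Fin (k + 2), inner ℝ (b i.succ) (b j.succ) = (if i = j then (3 / 4 : ℝ) else 0)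
      + 1 / 4 := by
    intro j
    split_ifs with h
    · subst h; rw [hb.hii]; norm_num
    · rw [hb.hij i j h]; norm_num
  have h' : inner ℝ (b i.succ) (b 0) = 0 := by rw [real_inner_comm, hb.h0]
  simp only [inner_smul_right, h, h', mul_zero, zero_add, mul_add, Finset.sum_add_distrib,
        mul_ite, mul_zero, Finset.sum_ite_eq, Finset.mem_univ, if_true, ← Finset.sum_mul]
  ring

theorem refl_apply (u x : Ed (k + 3)) :
    (ℝ ∙ u)ᗮ.reflection x = x - (2 * (inner ℝ u x / ‖u‖ ^ 2)) • u := by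
  rw [Submodule.reflection_orthogonal_apply, Submodule.reflection_singleton_apply]
  simp only [RCLike.ofReal_real_eq_id, id, two_smul, two_mul, add_smul]
  abel

variable (b) in
/-- The reflection in the hyperplane orthogonal to `b i.succ`. -/
def sr (i : Fin (k + 2)) : Ed (k + 3) ≃ₗᵢ[ℝ] Ed (k + 3) := (ℝ ∙ b i.succ)ᗮ.reflection

theorem sr_apply (hb : Good b) (i : Fin (k + 2)) (x : Ed (k + 3)) :
    sr b i x = x - (2 * inner ℝ (b i.succ) x) • b i.succ := by
  rw [sr, refl_apply, ← real_inner_self_eq_norm_sq, hb.hii, div_one]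

theorem sr_mul_self (i : Fin (k + 2)) : sr b i * sr b i = 1 :=
  Submodule.reflection_mul_reflection _

theorem sr_sr (i : Fin (k + 2)) (x : Ed (k + 3)) : sr b i (sr b i x) = x :=
  Submodule.reflection_reflection _ _

theorem repr_zero_sr (hb : Good b) (i : Fin (k + 2)) (x : Ed (k + 3)) :
    b.repr (sr b i x) 0 = b.repr x 0 := by
  simp [sr_apply hb, Finsupp.single_apply]

theorem sr_zero (hb : Good b) (i : Fin (k + 2)) : sr b i (b 0) = b 0 := by
  rw [sr_apply hb, real_inner_comm, hb.h0]; simp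

theorem sr_self (i : Fin (k + 2)) : sr b i (b i.succ) = - b i.succ :=
  Submodule.reflection_orthogonalComplement_singleton_eq_neg _

variable (b) in
/-- The horizontal lattice. -/
def HLat : AddSubgroup (Ed (k + 3)) where
  carrier := {x | b.repr x 0 = 0 ∧ ∀ j, ∃ z : ℤ, b.repr x j = z}
  zero_mem' := ⟨by simp, fun j => ⟨0, by simp⟩⟩
  add_mem' := by
    rintro x y ⟨hx, hx'⟩ ⟨hy, hy'⟩
    refine ⟨by simp [hx, hy], fun j => ?_⟩
    obtain ⟨z, hz⟩ := hx' j
    obtain ⟨z', hz'⟩ := hy' j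
    exact ⟨z + z', by simp [hz, hz']⟩
  neg_mem' := by
    rintro x ⟨hx, hx'⟩
    refine ⟨by simp [hx], fun j => ?_⟩
    obtain ⟨z, hz⟩ := hx' j
    exact ⟨-z, by simp [hz]⟩

theorem basis_mem_HLat (i : Fin (k + 2)) : b i.succ ∈ HLat b := by
  refine ⟨by simp [Finsupp.single_apply], fun j => ?_⟩
  by_cases h : i.succ = j
  · exact ⟨1, by simp [h]⟩
  · exact ⟨0, by simp [h]⟩

/-- The reflections map the lattice to the half-translated lattices. -/
theorem sr_HLat (hb : Good b) (i : Fin (k + 2)) {x : Ed (k + 3)} (hx : x ∈ HLat b) :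
    sr b i x ∈ HLat b ∨ sr b i x + (1 / 2 : ℝ) • b i.succ ∈ HLat b := by
  choose h0 z hz using hx
  have h : 2 * inner ℝ (b i.succ) x = ((3 * z i.succ + ∑ j : Fin (k + 2), z j.succ : ℤ) : ℝ) / 2 := by
    rw [hb.inner_succ]
    simp only [hz]
    push_cast
    ring
  rw [sr_apply hb, h]
  have hx : x ∈ HLat b := ⟨h0, fun j => ⟨z j, hz j⟩⟩
  rcases Int.even_or_odd' (3 * z i.succ + ∑ j : Fin (k + 2), z j.succ) with ⟨c, hc | hc⟩
  · left
    have := (HLat b).sub_mem hx ((HLat b).zsmul_mem (basis_mem_HLat i) c)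
    convert this using 2
    rw [hc, ← Int.cast_smul_eq_zsmul ℝ]
    push_cast
    congr 1
    ring
  · right
    have := (HLat b).sub_mem hx ((HLat b).zsmul_mem (basis_mem_HLat i) c)
    convert this using 1
    rw [hc, ← Int.cast_smul_eq_zsmul ℝ]
    push_cast
    module

/-- No nonzero vector stays in the lattice under all words in the reflections. -/
theorem eq_zero_of_words (hb : Good b) (w : Ed (k + 3))
    (hw : ∀ l : List (Fin (k + 2)), (l.map (sr b)).prod w ∈ HLat b) : w = 0 := by
  let M : Set (Ed (k + 3)) := {w | ∀ l : List (Fin (k + 2)), (l.map (sr b)).prod w ∈ HLat b}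
  have hML : ∀ x ∈ M, x ∈ HLat b := fun x hx => by simpa using hx []
  have hMs : ∀ x ∈ M, ∀ i, sr b i x ∈ M := by
    intro x hx i l
    simpa using hx (l ++ [i])
  have hMsub : ∀ x ∈ M, ∀ y ∈ M, x - y ∈ M := by
    intro x hx y hy l
    rw [map_sub]
    exact (HLat b).sub_mem (hx l) (hy l)
  have hMd : ∀ x ∈ M, ∀ i : Fin (k + 2), (2 * inner ℝ (b i.succ) x) • b i.succ ∈ M := by
    intro x hx i
    have := hMsub x hx _ (hMs x hx i)
    rwa [sr_apply hb, sub_sub_cancel] at this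
  have half : ∀ t : ℝ, (∃ i : Fin (k + 2), t • b i.succ ∈ M) →
      ∃ i : Fin (k + 2), (t / 2) • b i.succ ∈ M := by
    rintro t ⟨i, hi⟩
    obtain ⟨j, hj⟩ := exists_ne i
    refine ⟨j, ?_⟩
    have := hMd _ hi j
    rw [inner_smul_right, hb.hij j i hj] at this
    convert this using 2
    ring
  have int : ∀ t : ℝ, (∃ i : Fin (k + 2), t • b i.succ ∈ M) → ∃ z : ℤ, t = z := by
    rintro t ⟨i, hi⟩
    obtain ⟨z, hz⟩ := (hML _ hi).2 i.succ
    exact ⟨z, by simpa using hz⟩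
  have zero : ∀ t : ℝ, (∃ i : Fin (k + 2), t • b i.succ ∈ M) → t = 0 := by
    intro t ht
    have hn : ∀ n : ℕ, ∃ i : Fin (k + 2), (t / 2 ^ n) • b i.succ ∈ M := by
      intro n
      induction n with
      | zero => simpa using ht
      | succ n ih =>
        have := half _ ih
        rwa [div_div, ← pow_succ] at this
    obtain ⟨n, hn'⟩ := pow_unbounded_of_one_lt |t| (one_lt_two : (1 : ℝ) < 2)
    obtain ⟨z, hz⟩ := int _ (hn n)
    have h2 : (0 : ℝ) < 2 ^ n := by positivity
    have : |(z : ℝ)| < 1 := by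
      rw [← hz, abs_div, abs_of_pos h2, div_lt_one h2]
      exact hn'
    have hz0 : z = 0 := by
      have : |z| < 1 := by exact_mod_cast this
      exact Int.abs_lt_one_iff.1 this
    rw [hz0, Int.cast_zero, div_eq_zero_iff] at hz
    exact hz.resolve_right h2.ne'
  have horth : ∀ j, inner ℝ (b j) w = 0 := by
    intro j
    refine Fin.cases ?_ (fun i => ?_) j
    · rw [hb.inner_zero]
      exact (hML w hw).1
    · have := zero _ ⟨i, hMd w hw i⟩
      linarith
  have hself : inner ℝ w w = 0 := by
    conv_lhs => rw [← b.sum_repr w, sum_inner]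
    refine Finset.sum_eq_zero fun j _ => ?_
    rw [b.sum_repr, inner_smul_left, horth, mul_zero]
  exact inner_self_eq_zero.1 hself

/-! ## Tiles -/

variable (b) in
/-- The basic tiles. -/
def Q (z : Fin (k + 3) → ℤ) : Set (Ed (k + 3)) :=
  {x | ∀ j, (z j : ℝ) ≤ b.repr x j ∧ b.repr x j ≤ z j + 1}

variable (b) in
/-- The coordinate homeomorphism. -/
def crd : Ed (k + 3) ≃ₜ (Fin (k + 3) → ℝ) := b.equivFun.toContinuousLinearEquiv.toHomeomorph

theorem crd_apply (x : Ed (k + 3)) (j : Fin (k + 3)) : crd b x j = b.repr x j := rfl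

theorem Q_eq (z : Fin (k + 3) → ℤ) :
    Q b z = crd b ⁻¹' (univ.pi fun j => Icc (z j : ℝ) (z j + 1)) := by
  ext x
  simp only [Q, mem_setOf_eq, mem_preimage, mem_pi, mem_univ, true_imp_iff, mem_Icc, crd_apply]

theorem Q_compact (z : Fin (k + 3) → ℤ) : IsCompact (Q b z) := by
  rw [Q_eq, Homeomorph.isCompact_preimage]
  exact isCompact_univ_pi fun j => isCompact_Icc

theorem Q_convex (z : Fin (k + 3) → ℤ) : Convex ℝ (Q b z) := by
  intro x hx y hy s t hs ht hst j
  have h1 := hx j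
  have h2 := hy j
  simp only [map_add, map_smul, Finsupp.add_apply, Finsupp.smul_apply, smul_eq_mul]
  obtain rfl : s = 1 - t := by linarith
  constructor <;> nlinarith

theorem Q_interior (z : Fin (k + 3) → ℤ) :
    interior (Q b z) = {x | ∀ j, (z j : ℝ) < b.repr x j ∧ b.repr x j < z j + 1} := by
  rw [Q_eq, ← Homeomorph.preimage_interior, interior_pi_set finite_univ]
  ext x
  simp [crd_apply, mem_pi]

variable (b) in
/-- The point with given coordinates. -/
def pt (c : Fin (k + 3) → ℝ) : Ed (k + 3) := b.equivFun.symm c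

@[simp] theorem repr_pt (c : Fin (k + 3) → ℝ) (j : Fin (k + 3)) : b.repr (pt b c) j = c j := by
  have := congrFun (b.equivFun.apply_symm_apply c) j
  exact this

theorem Q_extreme {z : Fin (k + 3) → ℤ} {x : Ed (k + 3)} (hx : x ∈ (Q b z).extremePoints ℝ)
    (j : Fin (k + 3)) : b.repr x j = z j ∨ b.repr x j = z j + 1 := by
  by_contra hcon
  push Not at hcon
  obtain ⟨hxQ, hext⟩ := mem_extremePoints.1 hx
  have h1 := lt_of_le_of_ne (hxQ j).1 hcon.1.symm
  have h2 := lt_of_le_of_ne (hxQ j).2 hcon.2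
  obtain ⟨ε, hε, hε1, hε2⟩ : ∃ ε : ℝ, 0 < ε ∧ ε ≤ b.repr x j - z j ∧ ε ≤ z j + 1 - b.repr x j :=
    ⟨min (b.repr x j - z j) (z j + 1 - b.repr x j), by simp [h1, h2], min_le_left _ _,
      min_le_right _ _⟩
  have hmem : ∀ t : ℝ, |t| ≤ ε → x + t • b j ∈ Q b z := by
    intro t ht l
    have := hxQ l
    rw [abs_le] at ht
    by_cases h : j = l
    · subst h
      simp only [map_add, map_smul, Finsupp.add_apply, Finsupp.smul_apply, smul_eq_mul,
        Module.Basis.repr_self, Finsupp.single_eq_same, mul_one]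
      constructor <;> linarith
    · simpa [Finsupp.single_apply, h] using this
  have := (hext _ (hmem ε (abs_of_pos hε).le) _ (hmem (-ε) (by rw [abs_neg, abs_of_pos hε]))
    ⟨1 / 2, 1 / 2, by norm_num, by norm_num, by norm_num, by module⟩).1
  have h3 : ε • b j = 0 := by simpa using this
  exact (smul_ne_zero hε.ne' (b.ne_zero j)) h3

theorem extreme_image {f : Ed (k + 3) ≃ᵃⁱ[ℝ] Ed (k + 3)} {S : Set (Ed (k + 3))} {x : Ed (k + 3)}
    (hx : x ∈ (f '' S).extremePoints ℝ) : ∃ y ∈ S.extremePoints ℝ, f y = x := by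
  obtain ⟨⟨y, hy, rfl⟩, hext⟩ := mem_extremePoints.1 hx
  refine ⟨y, mem_extremePoints.2 ⟨hy, fun u hu v hv huv => ?_⟩, rfl⟩
  have := hext _ (mem_image_of_mem f hu) _ (mem_image_of_mem f hv) (by
    have h := image_openSegment ℝ (f.toAffineEquiv : Ed (k + 3) →ᵃ[ℝ] Ed (k + 3)) u v
    change f '' _ = openSegment ℝ (f u) (f v) at h
    rw [← h]
    exact mem_image_of_mem f huv)
  exact ⟨f.injective this.1, f.injective this.2⟩

theorem image_interior_iso (f : Ed (k + 3) ≃ᵃⁱ[ℝ] Ed (k + 3)) (S : Set (Ed (k + 3))) :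
    interior (f '' S) = f '' interior S := (f.toHomeomorph.image_interior S).symm

theorem Q_polytope (f : Ed (k + 3) ≃ᵃⁱ[ℝ] Ed (k + 3)) (z : Fin (k + 3) → ℤ) :
    IsConvexPolytope (k + 3) (f '' Q b z) := by
  refine ⟨(Q_compact z).image f.continuous, ?_, ?_, ?_⟩
  · exact (Q_convex (b := b) z).affine_image (f.toAffineEquiv : Ed (k + 3) →ᵃ[ℝ] Ed (k + 3))
  · rw [image_interior_iso]
    refine Nonempty.image _ ⟨pt b (fun j => z j + 1 / 2), ?_⟩
    rw [Q_interior]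
    intro j
    rw [repr_pt]
    constructor <;> linarith
  · have : (univ.pi fun j => ({(z j : ℝ), (z j : ℝ) + 1} : Set ℝ)).Finite :=
      Set.Finite.pi fun j => toFinite _
    refine ((this.image (crd b).symm).image f).subset ?_
    intro x hx
    obtain ⟨y, hy, rfl⟩ := extreme_image hx
    refine mem_image_of_mem _ ⟨crd b y, ?_, by simp⟩
    intro j _
    exact Q_extreme hy j

variable (b) in
/-- The basic layer. -/
def Lam0 : Set (Set (Ed (k + 3))) := {S | ∃ z : Fin (k + 3) → ℤ, z 0 = 0 ∧ S = Q b z}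

theorem act_Lam0_subset {f : Ed (k + 3) ≃ᵃⁱ[ℝ] Ed (k + 3)}
    (h : ∀ z : Fin (k + 3) → ℤ, z 0 = 0 → ∃ z' : Fin (k + 3) → ℤ, z' 0 = 0 ∧
      ∀ x, x ∈ Q b z ↔ f x ∈ Q b z') : act f (Lam0 b) ⊆ Lam0 b := by
  rintro _ ⟨_, ⟨z, hz, rfl⟩, rfl⟩
  obtain ⟨z', hz', h⟩ := h z hz
  refine ⟨z', hz', ?_⟩
  ext y
  constructor
  · rintro ⟨x, hx, rfl⟩
    exact (h x).1 hx
  · intro hy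
    refine ⟨f.symm y, (h _).2 (by simpa using hy), by simp⟩

theorem act_tr_Lam0 {w : Ed (k + 3)} (hw : w ∈ HLat b) : act (tr w) (Lam0 b) = Lam0 b := by
  have : ∀ w ∈ HLat b, act (tr w) (Lam0 b) ⊆ Lam0 b := by
    intro w hw
    apply act_Lam0_subset
    intro z hz
    choose h0 u hu using hw
    refine ⟨fun j => u j + z j, ?_, fun x => ?_⟩
    · have := hu 0
      rw [h0] at this
      have : u 0 = 0 := by exact_mod_cast this.symm
      simp [this, hz]
    · refine forall_congr' fun j => ?_
      rw [tr_apply]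
      simp only [map_add, Finsupp.add_apply, hu, Int.cast_add, add_assoc, add_le_add_iff_left]
  refine act_eq_of_subset (this w hw) ?_
  rw [tr_inv]
  exact this _ ((HLat b).neg_mem hw)

theorem act_invol_Lam0 {f : Ed (k + 3) ≃ᵃⁱ[ℝ] Ed (k + 3)} (hf : ∀ x, f (f x) = x)
    (h : act f (Lam0 b) ⊆ Lam0 b) : act f (Lam0 b) = Lam0 b := by
  refine act_eq_of_subset h ?_
  have : f⁻¹ = f := by
    rw [inv_eq_iff_mul_eq_one]
    ext x : 1
    simp [hf]
  rwa [this]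

variable (b) in
/-- Horizontal point reflection. -/
def Nm : Ed (k + 3) ≃ᵃⁱ[ℝ] Ed (k + 3) := (ℝ ∙ b 0).reflection.toAffineIsometryEquiv

theorem Phi_apply (hb : Good b) (x : Ed (k + 3)) :
    (ℝ ∙ b 0)ᗮ.reflection x = x - (2 * b.repr x 0) • b 0 := by
  rw [refl_apply, ← real_inner_self_eq_norm_sq, hb.h00, hb.inner_zero, div_one]

theorem Nm_apply (hb : Good b) (x : Ed (k + 3)) : Nm b x = -x + (2 * b.repr x 0) • b 0 := by
  have h := Phi_apply hb x
  rw [Submodule.reflection_orthogonal_apply, neg_eq_iff_eq_neg] at h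
  rw [Nm, LinearIsometryEquiv.coe_toAffineIsometryEquiv, h]
  abel

theorem act_Nm (hb : Good b) : act (Nm b) (Lam0 b) = Lam0 b := by
  apply act_invol_Lam0
  · intro x
    simp [Nm]
  · apply act_Lam0_subset
    intro z hz
    refine ⟨fun j => if j = 0 then 0 else -z j - 1, by simp, fun x => ?_⟩
    refine forall_congr' fun j => ?_
    rw [Nm_apply hb]
    by_cases hj : j = 0
    · subst hj
      simp [hz, two_mul]
    · simp only [hj, if_false, map_add, map_neg, map_smul, Finsupp.add_apply, Finsupp.neg_apply,
        Finsupp.smul_apply, Module.Basis.repr_self, smul_eq_mul]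
      rw [Finsupp.single_eq_of_ne hj]
      push_cast
      constructor <;> rintro ⟨h1, h2⟩ <;> constructor <;> linarith

variable (b) in
/-- Vertical flip of the basic layer. -/
def rho : Ed (k + 3) ≃ᵃⁱ[ℝ] Ed (k + 3) :=
  tr (b 0) * (ℝ ∙ b 0)ᗮ.reflection.toAffineIsometryEquiv

theorem rho_apply (hb : Good b) (x : Ed (k + 3)) :
    rho b x = b 0 + (x - (2 * b.repr x 0) • b 0) := by
  rw [← Phi_apply hb]; rfl

theorem act_rho (hb : Good b) : act (rho b) (Lam0 b) = Lam0 b := by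
  apply act_invol_Lam0
  · intro x
    simp only [rho_apply hb, map_add, map_sub, map_smul, Finsupp.add_apply, Finsupp.sub_apply,
        Finsupp.smul_apply, Module.Basis.repr_self, smul_eq_mul, Finsupp.single_eq_same]
    module
  · apply act_Lam0_subset
    intro z hz
    refine ⟨z, hz, fun x => ?_⟩
    refine forall_congr' fun j => ?_
    rw [rho_apply hb]
    simp only [map_add, map_sub, map_smul, Finsupp.add_apply, Finsupp.sub_apply,
        Finsupp.smul_apply, Module.Basis.repr_self, smul_eq_mul]
    by_cases hj : j = 0
    · subst hj
      simp only [hz, Finsupp.single_eq_same, Int.cast_zero]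
      constructor <;> rintro ⟨h1, h2⟩ <;> constructor <;> linarith
    · rw [Finsupp.single_eq_of_ne hj]
      simp

variable (b) in
/-- The isometry exchanging two horizontal basis vectors. -/
def prm (i j : Fin (k + 2)) : Ed (k + 3) ≃ₗᵢ[ℝ] Ed (k + 3) :=
  (ℝ ∙ (b i.succ - b j.succ))ᗮ.reflection

theorem prm_apply (hb : Good b) {i j : Fin (k + 2)} (hij : i ≠ j) (x : Ed (k + 3)) :
    prm b i j x = x - (b.repr x i.succ - b.repr x j.succ) • (b i.succ - b j.succ) := by
  rw [prm, refl_apply, ← real_inner_self_eq_norm_sq]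
  have h1 : inner ℝ (b i.succ - b j.succ) (b i.succ - b j.succ) = 3 / 2 := by
    rw [inner_sub_left, inner_sub_right, inner_sub_right, hb.hii, hb.hii, hb.hij i j hij,
      hb.hij j i hij.symm]
    norm_num
  have h2 : inner ℝ (b i.succ - b j.succ) x = 3 / 4 * (b.repr x i.succ - b.repr x j.succ) := by
    rw [inner_sub_left, hb.inner_succ, hb.inner_succ]
    ring
  rw [h1, h2]
  congr 2
  ring

theorem prm_zero (hb : Good b) {i j : Fin (k + 2)} (hij : i ≠ j) : prm b i j (b 0) = b 0 := by
  rw [prm_apply hb hij]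
  simp [Finsupp.single_apply, (Fin.succ_ne_zero _).symm]

theorem prm_left (hb : Good b) {i j : Fin (k + 2)} (hij : i ≠ j) :
    prm b i j (b i.succ) = b j.succ := by
  rw [prm_apply hb hij]
  simp [hij, Finsupp.single_apply]

theorem act_prm (hb : Good b) {i j : Fin (k + 2)} (hij : i ≠ j) :
    act (prm b i j).toAffineIsometryEquiv (Lam0 b) = Lam0 b := by
  apply act_invol_Lam0
  · intro x
    simp [prm]
  · apply act_Lam0_subset
    intro z hz
    refine ⟨fun l => z (Equiv.swap i.succ j.succ l), ?_, fun x => ?_⟩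
    · dsimp only
      rw [Equiv.swap_apply_of_ne_of_ne (Fin.succ_ne_zero _).symm (Fin.succ_ne_zero _).symm, hz]
    · rw [LinearIsometryEquiv.coe_toAffineIsometryEquiv]
      have h : ∀ l, b.repr (prm b i j x) l = b.repr x (Equiv.swap i.succ j.succ l) := by
        intro l
        rw [prm_apply hb hij]
        simp only [map_sub, map_smul, Finsupp.sub_apply,
          Finsupp.smul_apply, Module.Basis.repr_self, smul_eq_mul]
        have hs : i.succ ≠ j.succ := fun h => hij (Fin.succ_injective _ h)
        by_cases h1 : l = i.succ
        · subst h1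
          rw [Equiv.swap_apply_left, Finsupp.single_eq_same, Finsupp.single_eq_of_ne hs]
          ring
        · by_cases h2 : l = j.succ
          · subst h2
            rw [Equiv.swap_apply_right, Finsupp.single_eq_same, Finsupp.single_eq_of_ne h1]
            ring
          · rw [Equiv.swap_apply_of_ne_of_ne h1 h2, Finsupp.single_eq_of_ne h1,
              Finsupp.single_eq_of_ne h2]
            ring
      constructor
      · intro hx l
        rw [h]
        exact hx _
      · intro hx l
        have := hx (Equiv.swap i.succ j.succ l)
        rw [h] at this
        simpa using this

/-! ## Two adjacent layers -/

variable (b) in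
/-- The isometry carrying a layer to the next one. -/
def Am (i : Fin (k + 2)) : Ed (k + 3) ≃ᵃⁱ[ℝ] Ed (k + 3) :=
  tr ((1 / 4 : ℝ) • b i.succ + b 0) * (sr b i).toAffineIsometryEquiv

theorem Am_apply (i : Fin (k + 2)) (x : Ed (k + 3)) :
    Am b i x = ((1 / 4 : ℝ) • b i.succ + b 0) + sr b i x := rfl

theorem repr_zero_Am (hb : Good b) (i : Fin (k + 2)) (x : Ed (k + 3)) :
    b.repr (Am b i x) 0 = b.repr x 0 + 1 := by
  rw [Am_apply]
  simp only [map_add, map_smul, Finsupp.add_apply, Finsupp.smul_apply, Module.Basis.repr_self,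
    smul_eq_mul, repr_zero_sr hb, Finsupp.single_eq_same]
  rw [Finsupp.single_eq_of_ne (Fin.succ_ne_zero _).symm]
  ring

variable (b) in
/-- Two adjacent layers. -/
def Up (i : Fin (k + 2)) : Set (Set (Ed (k + 3))) := Lam0 b ∪ act (Am b i) (Lam0 b)

theorem act_tr_Up {i : Fin (k + 2)} {w : Ed (k + 3)} (hw : w ∈ HLat b)
    (hw' : sr b i w ∈ HLat b) : act (tr w) (Up b i) = Up b i := by
  have : tr w * Am b i = Am b i * tr (sr b i w) := by
    ext x : 1
    simp only [AffineIsometryEquiv.coe_mul, Function.comp, tr_apply, Am_apply, map_add, sr_sr]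
    abel
  rw [Up, act_union, act_tr_Lam0 hw, ← act_mul, this, act_mul, act_tr_Lam0 hw']

theorem act_Nm_Up (hb : Good b) {i : Fin (k + 2)} {w : Ed (k + 3)} (hw : w ∈ HLat b)
    (hw' : sr b i w + (1 / 2 : ℝ) • b i.succ ∈ HLat b) :
    act (tr w * Nm b) (Up b i) = Up b i := by
  have : tr w * Nm b * Am b i
      = Am b i * (tr (sr b i w + (1 / 2 : ℝ) • b i.succ) * Nm b) := by
    ext x : 1
    simp only [AffineIsometryEquiv.coe_mul, Function.comp, tr_apply, Nm_apply hb,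
      repr_zero_Am hb]
    simp only [Am_apply, map_add, sr_sr, map_smul, map_neg, sr_self, sr_zero hb]
    module
  rw [Up, act_union, ← act_mul (tr w * Nm b), this]
  simp only [act_mul, act_Nm hb, act_tr_Lam0 hw, act_tr_Lam0 hw']

theorem act_swap_Up (hb : Good b) (i : Fin (k + 2)) :
    act (Am b i * rho b) (Up b i) = Up b i := by
  have : Am b i * rho b * Am b i = rho b := by
    ext x : 1
    simp only [AffineIsometryEquiv.coe_mul, Function.comp]
    rw [Am_apply, rho_apply hb, repr_zero_Am hb, rho_apply hb]
    simp only [Am_apply, map_add, map_sub, sr_sr, map_smul, map_neg, sr_self, sr_zero hb]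
    module
  rw [Up, act_union, ← act_mul (Am b i * rho b), this, act_mul, act_rho hb, union_comm]

/-- All vertices of the common interface of two layers have congruent coronae. -/
theorem cong_Up (hb : Good b) (i : Fin (k + 2)) {y l : Ed (k + 3)} (hl : l ∈ HLat b)
    (hy : y = b 0 + l ∨ y = Am b i l) : Cong (Up b i) (b 0) (Up b i) y := by
  have h1 : Cong (Up b i) (b 0) (Up b i) (b 0 + l) := by
    rcases sr_HLat hb i hl with h | h
    · have := cong_act (Up b i) (tr l) (b 0)
      rw [act_tr_Up hl h, tr_apply, add_comm l] at this
      exact this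
    · have := cong_act (Up b i) (tr l * Nm b) (b 0)
      rw [act_Nm_Up hb hl h] at this
      convert this using 1
      simp only [AffineIsometryEquiv.coe_mul, Function.comp, tr_apply, Nm_apply hb,
        Module.Basis.repr_self, Finsupp.single_eq_same]
      module
  rcases hy with rfl | rfl
  · exact h1
  · refine h1.trans ?_
    have := cong_act (Up b i) (Am b i * rho b) (b 0 + l)
    rw [act_swap_Up hb] at this
    convert this using 1
    simp only [AffineIsometryEquiv.coe_mul, Function.comp, rho_apply hb]
    congr 1
    simp only [map_add, Finsupp.add_apply, hl.1, Module.Basis.repr_self, Finsupp.single_eq_same]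
    module

theorem cong_prm (hb : Good b) (i j : Fin (k + 2)) : Cong (Up b i) (b 0) (Up b j) (b 0) := by
  by_cases hij : i = j
  · subst hij
    exact cong_Up hb i (HLat b).zero_mem (Or.inl (by simp))
  have := cong_act (Up b i) (prm b i j).toAffineIsometryEquiv (b 0)
  rw [LinearIsometryEquiv.coe_toAffineIsometryEquiv, prm_zero hb hij] at this
  convert this using 1
  have h : (prm b i j).toAffineIsometryEquiv * Am b i
      = Am b j * (prm b i j).toAffineIsometryEquiv := by
    ext x : 1
    simp only [AffineIsometryEquiv.coe_mul, Function.comp, Am_apply,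
      LinearIsometryEquiv.coe_toAffineIsometryEquiv, map_add, map_smul, prm_zero hb hij,
      prm_left hb hij]
    have hin : inner ℝ (b j.succ) (prm b i j x) = inner ℝ (b i.succ) x := by
      have h := (prm b i j).inner_map_map (b i.succ) x
      rwa [prm_left hb hij] at h
    rw [sr_apply hb, sr_apply hb, map_sub, map_smul, prm_left hb hij, hin]
  rw [Up, Up, act_union, ← act_mul, h, act_mul, act_prm hb hij]

/-! ## The layered tiling -/

variable (b) in
/-- The tiling with layers `F n (Lam0 b)`. -/
def TT (F : ℤ → Ed (k + 3) ≃ᵃⁱ[ℝ] Ed (k + 3)) : Set (Set (Ed (k + 3))) :=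
  {S | ∃ n : ℤ, ∃ z : Fin (k + 3) → ℤ, z 0 = 0 ∧ S = F n '' Q b z}

variable {F : ℤ → Ed (k + 3) ≃ᵃⁱ[ℝ] Ed (k + 3)}

theorem TT_tiling (hF : ∀ n x, b.repr (F n x) 0 = b.repr x 0 + n) :
    IsTiling (k + 3) (TT b F) := by
  refine ⟨?_, ?_, ?_, ?_⟩
  · have : TT b F ⊆ range (fun p : ℤ × (Fin (k + 3) → ℤ) => F p.1 '' Q b p.2) := by
      rintro S ⟨n, z, -, rfl⟩
      exact ⟨(n, z), rfl⟩
    exact (countable_range _).mono this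
  · rintro S ⟨n, z, -, rfl⟩
    exact Q_polytope _ _
  · rw [eq_univ_iff_forall]
    intro x
    let n : ℤ := ⌊b.repr x 0⌋
    obtain ⟨y, hy⟩ := (F n).surjective x
    have h0 := hF n y
    rw [hy] at h0
    refine ⟨F n '' Q b (fun j => ⌊b.repr y j⌋), ⟨n, _, ?_, rfl⟩, y, ?_, hy⟩
    · rw [show b.repr y 0 = b.repr x 0 - n by linarith, Int.floor_sub_intCast]
      exact sub_self _
    · intro j
      exact ⟨Int.floor_le _, (Int.lt_floor_add_one _).le⟩
  · rintro S ⟨n, z, hz, rfl⟩ S' ⟨n', z', hz', rfl⟩ hne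
    rw [image_interior_iso, image_interior_iso, Q_interior, Q_interior, Set.disjoint_left]
    rintro _ ⟨y, hy, rfl⟩ ⟨y', hy', he⟩
    have huniq : ∀ (p q : ℤ) (t : ℝ), (p : ℝ) < t → t < p + 1 → (q : ℝ) < t → t < q + 1 →
        p = q := by
      intro p q t h1 h2 h3 h4
      have a1 : (p : ℝ) < q + 1 := by linarith
      have a2 : (q : ℝ) < p + 1 := by linarith
      have a1 : p < q + 1 := by exact_mod_cast a1
      have a2 : q < p + 1 := by exact_mod_cast a2
      omega
    have hn : n = n' := by
      have h1 := hF n y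
      have h2 := hF n' y'
      have h3 := hy 0
      have h4 := hy' 0
      rw [he] at h2
      rw [hz] at h3
      rw [hz'] at h4
      push_cast at h3 h4
      apply huniq n n' (b.repr (F n y) 0) <;> linarith
    subst hn
    have := (F n).injective he
    subst this
    apply hne
    congr 2
    funext j
    exact huniq _ _ _ (hy j).1 (hy j).2 (hy' j).1 (hy' j).2

theorem TT_not_ftf {i : Fin (k + 2)} {n : ℤ} (hstep : F (n + 1) = F n * Am b i) :
    ¬ FaceToFace (k + 3) (TT b F) := by
  intro hff
  have hsm : ∀ (t c : ℝ) (_ : 0 ≤ t ∧ t ≤ 1) (_ : 0 ≤ c ∧ c ≤ 1),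
      c • b 0 + t • b i.succ ∈ Q b 0 := by
    intro t c ht hc j
    simp only [map_add, map_smul, Finsupp.add_apply, Finsupp.smul_apply, Module.Basis.repr_self,
      smul_eq_mul, Pi.zero_apply, Int.cast_zero]
    refine Fin.cases ?_ (fun j => ?_) j
    · rw [Finsupp.single_eq_same, Finsupp.single_eq_of_ne (Fin.succ_ne_zero _).symm]
      constructor <;> linarith [hc.1, hc.2]
    · rw [Finsupp.single_eq_of_ne (Fin.succ_ne_zero _), Finsupp.single_apply]
      split_ifs <;> constructor <;> linarith [ht.1, ht.2]
  have hnot : F n (b 0 + b i.succ) ∉ F (n + 1) '' Q b 0 := by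
    rintro ⟨y, hy, he⟩
    rw [hstep] at he
    have he : Am b i y = b 0 + b i.succ := (F n).injective he
    have he2 : Am b i (-(3 / 4 : ℝ) • b i.succ) = b 0 + b i.succ := by
      rw [Am_apply, map_smul, sr_self]
      module
    have := (Am b i).injective (he.trans he2.symm)
    subst this
    have := (hy i.succ).1
    simp at this
    linarith
  have hQ : F n '' Q b 0 ∈ TT b F := ⟨n, 0, rfl, rfl⟩
  have hQ' : F (n + 1) '' Q b 0 ∈ TT b F := ⟨n + 1, 0, rfl, rfl⟩
  have hm1 : F n (b 0 + b i.succ) ∈ F n '' Q b 0 := by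
    refine mem_image_of_mem _ ?_
    simpa using hsm 1 1 (by norm_num) (by norm_num)
  have hm0 : F n (b 0) ∈ F n '' Q b 0 := by
    refine mem_image_of_mem _ ?_
    simpa using hsm 0 1 (by norm_num) (by norm_num)
  have hne : F n '' Q b 0 ≠ F (n + 1) '' Q b 0 := fun h => hnot (h ▸ hm1)
  have hext := (hff _ hQ _ hQ' hne).1
  have hmid : F n (b 0 + (1 / 4 : ℝ) • b i.succ) ∈ F n '' Q b 0 ∩ F (n + 1) '' Q b 0 := by
    constructor
    · refine mem_image_of_mem _ ?_
      simpa using hsm (1 / 4) 1 (by norm_num) (by norm_num)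
    · refine ⟨0, by simpa using hsm 0 0 (by norm_num) (by norm_num), ?_⟩
      rw [hstep]
      simp only [AffineIsometryEquiv.coe_mul, Function.comp, Am_apply, map_zero]
      congr 1
      abel
  have hseg : F n (b 0 + (1 / 4 : ℝ) • b i.succ) ∈
      openSegment ℝ (F n (b 0 + b i.succ)) (F n (b 0)) := by
    have h := image_openSegment ℝ ((F n).toAffineEquiv : Ed (k + 3) →ᵃ[ℝ] Ed (k + 3))
      (b 0 + b i.succ) (b 0)
    change F n '' _ = openSegment ℝ (F n _) (F n _) at h
    rw [← h]
    refine mem_image_of_mem _ ⟨1 / 4, 3 / 4, by norm_num, by norm_num, by norm_num, by module⟩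
  exact hnot (hext.left_mem_of_mem_openSegment hm1 hm0 hmid hseg).2

theorem TT_mono (hb : Good b) (hF : ∀ n x, b.repr (F n x) 0 = b.repr x 0 + n)
    (iz : ℤ → Fin (k + 2)) (hstep : ∀ n, F (n + 1) = F n * Am b (iz n)) :
    MonocoronalC (k + 3) (TT b F) := by
  have key : ∀ x, IsVertex (k + 3) (TT b F) x → Cong (Up b 0) (b 0) (TT b F) x := by
    rintro x ⟨S, ⟨n, z, hz, rfl⟩, hx⟩
    obtain ⟨y, hy, rfl⟩ := extreme_image hx
    have hyc := Q_extreme hy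
    have hyz : ∀ j, ∃ z : ℤ, b.repr y j = z := by
      intro j
      rcases hyc j with h | h
      · exact ⟨_, h⟩
      · exact ⟨z j + 1, by push_cast; exact h⟩
    -- normal form of vertices
    obtain ⟨m, l, u, hl, hxu, hu⟩ : ∃ m : ℤ, ∃ l u : Ed (k + 3), l ∈ HLat b ∧ F n y = F m u ∧
        (u = b 0 + l ∨ u = Am b (iz m) l) := by
      rcases hyc 0 with h | h
      · refine ⟨n - 1, y, Am b (iz (n - 1)) y, ⟨by rw [h, hz, Int.cast_zero], hyz⟩, ?_, Or.inr rfl⟩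
        have := hstep (n - 1)
        rw [sub_add_cancel] at this
        rw [this]
        rfl
      · refine ⟨n, y - b 0, y, ⟨?_, fun j => ?_⟩, rfl, Or.inl (by abel)⟩
        · simp [h, hz]
        · obtain ⟨c, hc⟩ := hyz j
          by_cases hj : j = 0
          · subst hj
            exact ⟨c - 1, by simp [hc]⟩
          · exact ⟨c, by simp [hc, Finsupp.single_apply, Ne.symm hj]⟩
    rw [hxu]
    refine (cong_prm hb 0 (iz m)).trans ((cong_Up hb (iz m) hl hu).trans ?_)
    have hu0 : b.repr u 0 = 1 := by
      rcases hu with rfl | rfl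
      · simp [hl.1]
      · rw [repr_zero_Am hb, hl.1, zero_add]
    have hc := cong_act (Up b (iz m)) (F m) u
    obtain ⟨f, hf, hf'⟩ := hc
    refine ⟨f, hf, hf'.trans ?_⟩
    rw [Up, act_union, ← act_mul, ← hstep]
    ext S
    constructor
    · rintro ⟨h | h, hm⟩
      · obtain ⟨_, ⟨z, hz, rfl⟩, rfl⟩ := h
        exact ⟨⟨_, z, hz, rfl⟩, hm⟩
      · obtain ⟨_, ⟨z, hz, rfl⟩, rfl⟩ := h
        exact ⟨⟨_, z, hz, rfl⟩, hm⟩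
    · rintro ⟨⟨n', z', hz', rfl⟩, hm⟩
      refine ⟨?_, hm⟩
      obtain ⟨y', hy', he⟩ := hm
      have h1 := hF n' y'
      have h2 := hy' 0
      rw [he, hF, hu0] at h1
      rw [hz'] at h2
      push_cast at h2
      have h3 : (n' : ℝ) ≤ m + 1 := by linarith
      have h4 : (m : ℝ) ≤ n' := by linarith
      have h3 : n' ≤ m + 1 := by exact_mod_cast h3
      have h4 : m ≤ n' := by exact_mod_cast h4
      obtain rfl | rfl : n' = m ∨ n' = m + 1 := by omega
      · exact Or.inl ⟨_, ⟨z', hz', rfl⟩, rfl⟩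
      · exact Or.inr ⟨_, ⟨z', hz', rfl⟩, rfl⟩
  intro x y hx hy
  exact (key x hx).symm.trans (key y hy)


/-! ## Non-periodicity -/

theorem map_add_lin (f : Ed (k + 3) ≃ᵃⁱ[ℝ] Ed (k + 3)) (w x : Ed (k + 3)) :
    f (w + x) = f.linearIsometryEquiv w + f x := f.map_vadd x w

theorem height_F (hb : Good b) (hF0 : F 0 = 1) (iz : ℤ → Fin (k + 2))
    (hstep : ∀ n, F (n + 1) = F n * Am b (iz n)) (n : ℤ) :
    ∀ x, b.repr (F n x) 0 = b.repr x 0 + n := by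
  induction n using Int.induction_on with
  | zero => intro x; simp [hF0]
  | succ n ih =>
    intro x
    rw [hstep, AffineIsometryEquiv.coe_mul, Function.comp, ih, repr_zero_Am hb]
    push_cast
    ring
  | pred n ih =>
    intro x
    obtain ⟨y, rfl⟩ := (Am b (iz (-n - 1))).surjective x
    have h := hstep (-n - 1)
    rw [sub_add_cancel] at h
    have h2 : F (-n - 1) (Am b (iz (-n - 1)) y) = F (-n) y := by
      rw [h]; rfl
    rw [h2, ih, repr_zero_Am hb]
    push_cast
    ring

theorem pt_mem_Q (z : Fin (k + 3) → ℤ) :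
    pt b (fun j => (z j : ℝ)) ∈ Q b z ∧ pt b (fun j => (z j : ℝ) + 1) ∈ Q b z := by
  constructor
  · intro j; rw [repr_pt]; constructor <;> linarith
  · intro j; rw [repr_pt]; constructor <;> linarith

theorem tr_F (f : Ed (k + 3) ≃ᵃⁱ[ℝ] Ed (k + 3)) (w : Ed (k + 3)) :
    tr w * f = f * tr (f.linearIsometryEquiv.symm w) := by
  ext x : 1
  simp only [AffineIsometryEquiv.coe_mul, Function.comp, tr_apply, map_add_lin,
    LinearIsometryEquiv.apply_symm_apply]

theorem lat_of_tile {f : Ed (k + 3) ≃ᵃⁱ[ℝ] Ed (k + 3)} {w : Ed (k + 3)}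
    {z z' : Fin (k + 3) → ℤ} (hz : z 0 = 0) (hz' : z' 0 = 0)
    (h : tr w '' (f '' Q b z) = f '' Q b z') : f.linearIsometryEquiv.symm w ∈ HLat b := by
  rw [← image_comp, ← AffineIsometryEquiv.coe_mul, tr_F, AffineIsometryEquiv.coe_mul,
    image_comp] at h
  have h := f.injective.image_injective h
  set u := f.linearIsometryEquiv.symm w
  have h1 : u + pt b (fun j => (z j : ℝ)) ∈ Q b z' := h ▸ mem_image_of_mem (tr u) (pt_mem_Q z).1
  have h2 : u + pt b (fun j => (z j : ℝ) + 1) ∈ Q b z' :=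
    h ▸ mem_image_of_mem (tr u) (pt_mem_Q z).2
  have key : ∀ j, b.repr u j = ((z' j - z j : ℤ) : ℝ) := by
    intro j
    have a1 := (h1 j).1
    have a2 := (h2 j).2
    simp only [map_add, Finsupp.add_apply, repr_pt] at a1 a2
    push_cast
    linarith
  exact ⟨by rw [key, hz, hz']; simp, fun j => ⟨_, key j⟩⟩

theorem tile_of_lat {f : Ed (k + 3) ≃ᵃⁱ[ℝ] Ed (k + 3)} {w : Ed (k + 3)}
    (hw : f.linearIsometryEquiv.symm w ∈ HLat b) {z : Fin (k + 3) → ℤ} (hz : z 0 = 0) :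
    ∃ z' : Fin (k + 3) → ℤ, z' 0 = 0 ∧ tr w '' (f '' Q b z) = f '' Q b z' := by
  have h : tr (f.linearIsometryEquiv.symm w) '' Q b z ∈ Lam0 b := by
    rw [← act_tr_Lam0 hw]
    exact ⟨_, ⟨z, hz, rfl⟩, rfl⟩
  obtain ⟨z', hz', he⟩ := h
  refine ⟨z', hz', ?_⟩
  rw [← image_comp, ← AffineIsometryEquiv.coe_mul, tr_F, AffineIsometryEquiv.coe_mul,
    image_comp, he]

theorem period_height (hF : ∀ n x, b.repr (F n x) 0 = b.repr x 0 + n) {v : Ed (k + 3)} {n m : ℤ}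
    {z z' : Fin (k + 3) → ℤ} (hz : z 0 = 0) (hz' : z' 0 = 0)
    (h : tr v '' (F n '' Q b z) = F m '' Q b z') : b.repr v 0 = ((m - n : ℤ) : ℝ) := by
  have mem : ∀ x ∈ Q b z, b.repr v 0 + (b.repr x 0 + n) - m ∈ Icc (0 : ℝ) 1 := by
    intro x hx
    have h1 : tr v (F n x) ∈ F m '' Q b z' :=
      h ▸ mem_image_of_mem (tr v) (mem_image_of_mem (F n) hx)
    obtain ⟨y, hy, he⟩ := h1
    have h2 := hF m y
    rw [he, tr_apply, map_add, Finsupp.add_apply, hF] at h2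
    have h3 := hy 0
    rw [hz'] at h3
    push_cast at h3
    constructor <;> linarith [h3.1, h3.2]
  have h1 := mem _ (pt_mem_Q z).1
  have h2 := mem _ (pt_mem_Q z).2
  simp only [repr_pt, hz, Int.cast_zero, mem_Icc] at h1 h2
  push_cast
  linarith [h1.1, h2.2]

theorem period_shift (hF : ∀ n x, b.repr (F n x) 0 = b.repr x 0 + n) {v : Ed (k + 3)}
    (hv : act (tr v) (TT b F) = TT b F) : ∃ c : ℤ, b.repr v 0 = c ∧
      ∀ (n : ℤ) (z : Fin (k + 3) → ℤ), z 0 = 0 →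
        ∃ z' : Fin (k + 3) → ℤ, z' 0 = 0 ∧ tr v '' (F n '' Q b z) = F (n + c) '' Q b z' := by
  have h : ∀ (n : ℤ) (z : Fin (k + 3) → ℤ), z 0 = 0 → ∃ m : ℤ,
        ∃ z' : Fin (k + 3) → ℤ, z' 0 = 0 ∧ tr v '' (F n '' Q b z) = F m '' Q b z' := by
    intro n z hz
    have : tr v '' (F n '' Q b z) ∈ TT b F := by
      rw [← hv]
      exact ⟨_, ⟨n, z, hz, rfl⟩, rfl⟩
    exact this
  obtain ⟨m, z', hz', he⟩ := h 0 0 rfl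
  have hc := period_height hF (z := 0) rfl hz' he
  refine ⟨m - 0, hc, fun n z hz => ?_⟩
  obtain ⟨m', z'', hz'', he'⟩ := h n z hz
  have hc' := period_height hF hz hz'' he'
  rw [hc] at hc'
  have : m - 0 = m' - n := by exact_mod_cast hc'
  obtain rfl : m' = n + (m - 0) := by omega
  exact ⟨z'', hz'', he'⟩

theorem lat_shift (hF : ∀ n x, b.repr (F n x) 0 = b.repr x 0 + n) {v : Ed (k + 3)} {c : ℤ}
    (hv : ∀ (n : ℤ) (z : Fin (k + 3) → ℤ), z 0 = 0 →
        ∃ z' : Fin (k + 3) → ℤ, z' 0 = 0 ∧ tr v '' (F n '' Q b z) = F (n + c) '' Q b z')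
    {n : ℤ} {w : Ed (k + 3)} (hw : (F n).linearIsometryEquiv.symm w ∈ HLat b) :
    (F (n + c)).linearIsometryEquiv.symm w ∈ HLat b := by
  obtain ⟨z1, hz1, h1⟩ := tile_of_lat hw (z := 0) rfl
  obtain ⟨z2, hz2, h2⟩ := hv n 0 rfl
  obtain ⟨z3, hz3, h3⟩ := hv n z1 hz1
  apply lat_of_tile hz2 hz3
  rw [← h2, ← h3, ← h1]
  simp only [image_image, tr_apply]
  refine image_congr fun x _ => ?_
  abel

theorem TT_nonperiodic (hb : Good b) (hF : ∀ n x, b.repr (F n x) 0 = b.repr x 0 + n)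
    (i0 : Fin (k + 2))
    (hneg : ∀ n : ℤ, n ≤ 0 → (F n).linearIsometryEquiv.symm (b i0.succ) ∈ HLat b)
    (hpos : ∀ l : List (Fin (k + 2)), ∃ n : ℕ,
      (F n).linearIsometryEquiv.symm = (l.map (sr b)).prod)
    {v : Ed (k + 3)} (hv : act (tr v) (TT b F) = TT b F) : v = 0 := by
  have hz : ∀ w, (∀ n : ℕ, (F n).linearIsometryEquiv.symm w ∈ HLat b) → w = 0 := by
    intro w hw
    apply eq_zero_of_words hb
    intro l
    obtain ⟨n, hn⟩ := hpos l
    rw [← hn]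
    exact hw n
  have hcontra : ∀ u, act (tr u) (TT b F) = TT b F → ∀ c : ℤ, 0 < c → b.repr u 0 = c → False := by
    intro u hu c hc huc
    obtain ⟨c', hc', hs⟩ := period_shift hF hu
    rw [huc] at hc'
    obtain rfl : c = c' := by exact_mod_cast hc'
    have hall : ∀ (j : ℕ) (n : ℤ), n ≤ j → (F n).linearIsometryEquiv.symm (b i0.succ) ∈ HLat b := by
      intro j
      induction j with
      | zero => intro n hn; exact hneg n (by simpa using hn)
      | succ j ih =>
        intro n hn
        have := lat_shift hF hs (ih (n - c) (by push_cast at hn; omega))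
        rwa [sub_add_cancel] at this
    exact b.ne_zero _ (hz (b i0.succ) fun n => hall n n le_rfl)
  obtain ⟨c, hc, hs⟩ := period_shift hF hv
  rcases lt_trichotomy c 0 with h | h | h
  · exfalso
    refine hcontra (-v) ?_ (-c) (by omega) (by simp [hc])
    conv_lhs => rw [← hv]
    rw [← act_mul, ← tr_inv, inv_mul_cancel, act_one]
  · subst h
    apply hz
    intro n
    obtain ⟨z', hz', he⟩ := hs n 0 rfl
    rw [add_zero] at he
    exact lat_of_tile rfl hz' he
  · exact (hcontra v hv c h hc).elim

theorem lin_mul (f g : Ed (k + 3) ≃ᵃⁱ[ℝ] Ed (k + 3)) :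
    (f * g).linearIsometryEquiv = f.linearIsometryEquiv * g.linearIsometryEquiv := by
  ext w : 1
  have h1 := map_add_lin (f * g) w 0
  have h2 : f (g (w + 0)) = f.linearIsometryEquiv (g.linearIsometryEquiv w) + f (g 0) := by
    rw [map_add_lin, map_add_lin]
  exact add_right_cancel (h1.symm.trans h2)

theorem lin_Am (i : Fin (k + 2)) : (Am b i).linearIsometryEquiv = sr b i := by
  ext w : 1
  have h1 := map_add_lin (Am b i) w 0
  rw [Am_apply, Am_apply, map_add, add_left_comm] at h1
  exact add_right_cancel h1.symm

end geom

theorem exists_tiling (k : ℕ) :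
    ∃ T : Set (Set (Ed (k + 3))), IsTiling (k + 3) T ∧ ¬ FaceToFace (k + 3) T ∧
      MonocoronalC (k + 3) T ∧ ∀ v : Ed (k + 3), v ∈ periodVectors (k + 3) T → v = 0 := by
  obtain ⟨b, hb⟩ := exists_good k
  obtain ⟨i, f, hf0, hfs, hfw⟩ := exists_walk (0 : Fin (k + 2)) (sr b) sr_mul_self
  let Fn : ℕ → Ed (k + 3) ≃ᵃⁱ[ℝ] Ed (k + 3) := fun n => Nat.rec 1 (fun n p => p * Am b (i n)) n
  let F : ℤ → Ed (k + 3) ≃ᵃⁱ[ℝ] Ed (k + 3) := fun n =>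
    if 0 ≤ n then Fn n.toNat else (Am b 0) ^ n
  let iz : ℤ → Fin (k + 2) := fun n => if 0 ≤ n then i n.toNat else 0
  have hF0 : F 0 = 1 := rfl
  have hFneg : ∀ n : ℤ, n ≤ 0 → F n = (Am b 0) ^ n := by
    intro n hn
    rcases hn.lt_or_eq with h | rfl
    · simp only [F]
      rw [if_neg (by omega)]
    · rw [hF0, zpow_zero]
  have hFpos : ∀ n : ℕ, F n = Fn n := by
    intro n
    simp [F]
  have hstep : ∀ n, F (n + 1) = F n * Am b (iz n) := by
    intro n
    by_cases hn : 0 ≤ n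
    · lift n to ℕ using hn
      have h : F ((n : ℤ) + 1) = Fn (n + 1) := by
        have h' := hFpos (n + 1)
        push_cast at h'
        exact h'
      rw [h, hFpos]
      simp only [iz, Int.natCast_nonneg, if_true, Int.toNat_natCast]
      rfl
    · rw [hFneg n (by omega), hFneg (n + 1) (by omega), zpow_add_one]
      simp only [iz, if_neg hn]
  have hF := height_F hb hF0 iz hstep
  have hlin : ∀ n : ℕ, (F n).linearIsometryEquiv = f n := by
    intro n
    induction n with
    | zero =>
      rw [hf0]
      ext w : 1
      have h1 := map_add_lin (F 0) w 0
      rw [hF0] at h1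
      simp only [Nat.cast_zero]
      rw [hF0]
      simpa using h1.symm
    | succ n ih =>
      have h := hstep n
      simp only [iz, Int.natCast_nonneg, if_true, Int.toNat_natCast] at h
      push_cast
      rw [h, lin_mul, ih, lin_Am, hfs]
  refine ⟨TT b F, TT_tiling hF, TT_not_ftf (hstep 0), TT_mono hb hF iz hstep, fun v hv => ?_⟩
  refine TT_nonperiodic hb hF 0 ?_ ?_ hv
  · have hneg : ∀ m : ℕ, (F (-m)).linearIsometryEquiv (b (0 : Fin (k + 2)).succ)
        = b (0 : Fin (k + 2)).succ ∨
        (F (-m)).linearIsometryEquiv (b (0 : Fin (k + 2)).succ) = - b (0 : Fin (k + 2)).succ := by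
      intro m
      induction m with
      | zero =>
        left
        have h := hlin 0
        simp only [Nat.cast_zero, neg_zero] at h ⊢
        rw [h, hf0]
        rfl
      | succ m ih =>
        have h := hstep (-((m + 1 : ℕ) : ℤ))
        have e : -((m + 1 : ℕ) : ℤ) + 1 = -m := by push_cast; ring
        have e2 : iz (-((m + 1 : ℕ) : ℤ)) = 0 := by
          simp only [iz]
          rw [if_neg (by omega)]
        rw [e, e2] at h
        rw [h, lin_mul, lin_Am] at ih
        simp only [LinearIsometryEquiv.coe_mul, Function.comp, sr_self, map_neg] at ih
        rcases ih with ih | ih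
        · right; exact neg_eq_iff_eq_neg.1 ih
        · left; exact neg_injective ih
    intro n hn
    obtain ⟨m, rfl⟩ : ∃ m : ℕ, n = -m := ⟨n.natAbs, by omega⟩
    rcases hneg m with h | h
    · rw [(LinearIsometryEquiv.symm_apply_eq _).2 h.symm]
      exact basis_mem_HLat 0
    · have h' : (F (-m)).linearIsometryEquiv (- b (0 : Fin (k + 2)).succ)
          = b (0 : Fin (k + 2)).succ := by rw [map_neg, h, neg_neg]
      rw [(LinearIsometryEquiv.symm_apply_eq _).2 h'.symm]
      exact (HLat b).neg_mem (basis_mem_HLat 0)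
  · intro l
    obtain ⟨n, hn⟩ := hfw l.reverse
    refine ⟨n, ?_⟩
    rw [hlin, hn]
    have hrev : ∀ l : List (Fin (k + 2)), ((l.reverse.map (sr b)).prod)⁻¹ = (l.map (sr b)).prod := by
      intro l
      induction l with
      | nil => simp
      | cons a t ih =>
        simp only [List.map_cons, List.prod_cons, List.reverse_cons, List.map_append,
          List.prod_append, List.map_nil, List.prod_nil, mul_one, mul_inv_rev, ih]
        rw [inv_eq_of_mul_eq_one_left (sr_mul_self a)]
    exact hrev l

/-- For every `d ≥ 3` there is a non-face-to-face monocoronal (up to congruence)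
tiling of `ℝ^d` that is non-periodic. -/
theorem exists_nonFaceToFace_monocoronalC_nonperiodic (hd : 3 ≤ d) :
    ∃ T : Set (Set (Ed d)), IsTiling d T ∧ ¬ FaceToFace d T ∧ MonocoronalC d T ∧
      ∀ v : Ed d, v ∈ periodVectors d T → v = 0 := by
  obtain ⟨k, rfl⟩ : ∃ k, d = k + 3 := ⟨d - 3, by omega⟩
  exact exists_tiling k
end
end
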